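/- arXiv:math/0209316 — 3 statements merged into one kernel-verified Lean document; each statement's English description precedes it below -/
import Mathlib

section
/- Let C₁ and C₂ be balanced circles in a gain graph such that C₁ ∪ C₂ is a theta graph. Then the symmetric difference C₁ + C₂ is a balanced circle. -/
set_option maxHeartbeats 1000000
set_option synthInstance.maxHeartbeats 400000

attribute [local instance] Classical.propDecidable

noncomputable section

/-- A multigraph: loops and multiple edges are allowed.  Each edge `e` has a
reference orientation, from `src e` to `tgt e`. -/
structure MGraph : Type 1 where
  V : Type
  E : Type
  src : E → V
  tgt : E → V

/-- A class of groups (a property of groups). -/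
abbrev GroupClass : Type 1 := (G : Type) → Group G → Prop

/-- A subgroup-closed class of groups. -/
def SubgroupClosed (𝒢 : GroupClass) : Prop :=
  ∀ (G : Type) [instG : Group G], 𝒢 G instG → ∀ H : Subgroup G, 𝒢 H inferInstance

/-- The number of occurrences of `a` in the list `l`. -/
def countIn {α : Type} (l : List α) (a : α) : ℕ :=
  (l.map fun x => if x = a then 1 else 0).sum

namespace MGraph

/-- A step of a walk: an edge together with a direction of traversal
(`true` = from `src` to `tgt`). -/
abbrev Step (Γ : MGraph) : Type := Γ.E × Bool

def stepStart (Γ : MGraph) (s : Γ.Step) : Γ.V := if s.2 then Γ.src s.1 else Γ.tgt s.1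

def stepEnd (Γ : MGraph) (s : Γ.Step) : Γ.V := if s.2 then Γ.tgt s.1 else Γ.src s.1

/-- `IsWalkFrom Γ a b l`: the list of steps `l` is a walk from `a` to `b`. -/
inductive IsWalkFrom (Γ : MGraph) : Γ.V → Γ.V → List Γ.Step → Prop
  | nil (v : Γ.V) : IsWalkFrom Γ v v []
  | cons {a b : Γ.V} {s : Γ.Step} {l : List Γ.Step} :
      Γ.stepStart s = a → IsWalkFrom Γ (Γ.stepEnd s) b l → IsWalkFrom Γ a b (s :: l)

section Walks

variable (Γ : MGraph)

/-- The list of edges underlying a walk. -/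
def walkEdges (l : List Γ.Step) : List Γ.E := l.map Prod.fst

/-- The list of vertices visited by a walk starting at `a`. -/
def walkVerts (a : Γ.V) (l : List Γ.Step) : List Γ.V := a :: l.map Γ.stepEnd

/-- A closed walk (given as its list of steps) is simple if it is nontrivial and
repeats no edge and no vertex (except that initial vertex = final vertex). -/
def IsSimpleClosed (l : List Γ.Step) : Prop :=
  l ≠ [] ∧ (Γ.walkEdges l).Nodup ∧ (l.map Γ.stepStart).Nodup

section Gain

variable {G : Type} [Group G]

/-- The gain of a single step, for a gain function `g`. -/
def stepGain (g : Γ.E → G) (s : Γ.Step) : G := if s.2 then g s.1 else (g s.1)⁻¹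

/-- The gain of a walk: the product of the gains of its steps, in order. -/
def walkGain (g : Γ.E → G) (l : List Γ.Step) : G := (l.map (Γ.stepGain g)).prod

/-- A gain graph is balanced if every simple closed walk has gain `1`. -/
def IsBalanced (g : Γ.E → G) : Prop :=
  ∀ (v : Γ.V) (l : List Γ.Step),
    Γ.IsWalkFrom v v l → Γ.IsSimpleClosed l → Γ.walkGain g l = 1

end Gain

/-- The mod-2 boundary map from edge chains to vertex chains. -/
def boundary : (Γ.E →₀ ZMod 2) →ₗ[ZMod 2] (Γ.V →₀ ZMod 2) :=
  Finsupp.lsum (ZMod 2) fun e => Finsupp.lsingle (Γ.src e) + Finsupp.lsingle (Γ.tgt e)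

/-- The binary cycle space `Z₁(Γ; ℤ₂)`: mod-2 edge chains with even degree at
every vertex. -/
def cycleSpace : Submodule (ZMod 2) (Γ.E →₀ ZMod 2) := LinearMap.ker Γ.boundary

/-- `B` is a basis of the binary cycle space of `Γ`. -/
def IsCycleBasis (B : Set (Γ.E →₀ ZMod 2)) : Prop :=
  (∀ c ∈ B, c ∈ Γ.cycleSpace) ∧
  LinearIndependent (ZMod 2) (fun c : B => c.1) ∧
  ∀ c ∈ Γ.cycleSpace, c ∈ Submodule.span (ZMod 2) B

/-- The closed walk `l` is a cyclic orientation of the binary cycle `c`: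
it is closed and its edge multiplicities reduced mod 2 give `c`. -/
def IsCyclicOrientation (c : Γ.E →₀ ZMod 2) (l : List Γ.Step) : Prop :=
  (∃ v, Γ.IsWalkFrom v v l) ∧ ∀ e : Γ.E, c e = (countIn (Γ.walkEdges l) e : ZMod 2)

/-- The binary cycle `c` is a circle: it is the (indicator of the) edge set of a
simple closed walk. -/
def IsCircleCycle (c : Γ.E →₀ ZMod 2) : Prop :=
  ∃ l, Γ.IsSimpleClosed l ∧ Γ.IsCyclicOrientation c l

section Tests

variable {G : Type} [Group G]

/-- `B` passes the Binary Cycle Test: it has a cyclic orientation all of whose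
closed walks have gain `1`. -/
def PassesBCT (g : Γ.E → G) (B : Set (Γ.E →₀ ZMod 2)) : Prop :=
  ∀ c ∈ B, ∃ l, Γ.IsCyclicOrientation c l ∧ Γ.walkGain g l = 1

/-- The Binary Cycle Test is valid for the gain graph `(Γ, g, G)`. -/
def BCTValid (g : Γ.E → G) : Prop :=
  (∃ B, Γ.IsCycleBasis B ∧ Γ.PassesBCT g B) → Γ.IsBalanced g

/-- `c` is a circle whose natural traversal as a simple closed walk has gain 1. -/
def IsBalancedCircleCycle (g : Γ.E → G) (c : Γ.E →₀ ZMod 2) : Prop :=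
  ∃ l, Γ.IsSimpleClosed l ∧ Γ.IsCyclicOrientation c l ∧ Γ.walkGain g l = 1

/-- The Circle Test is valid for the gain graph `(Γ, g, G)`: if some basis of the
binary cycle space consists of balanced circles, then the gain graph is balanced. -/
def CircleTestValid (g : Γ.E → G) : Prop :=
  (∃ B, Γ.IsCycleBasis B ∧ ∀ c ∈ B, Γ.IsBalancedCircleCycle g c) → Γ.IsBalanced g

end Tests

/-- The Binary Cycle Test is valid for `Γ` with respect to the class `𝒢`. -/
def BCTValidFor (𝒢 : GroupClass) : Prop :=
  ∀ (G : Type) [instG : Group G], 𝒢 G instG → ∀ g : Γ.E → G, Γ.BCTValid g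

/-- The Circle Test is valid for `Γ` with respect to the class `𝒢`
(`Γ` is a "good" graph for `𝒢`). -/
def CircleTestValidFor (𝒢 : GroupClass) : Prop :=
  ∀ (G : Type) [instG : Group G], 𝒢 G instG → ∀ g : Γ.E → G, Γ.CircleTestValid g

/-- Deletion of a set of edges. -/
def deleteEdges (S : Set Γ.E) : MGraph where
  V := Γ.V
  E := {e : Γ.E // e ∉ S}
  src e := Γ.src e.1
  tgt e := Γ.tgt e.1

/-- The relation identifying the two endpoints of each edge of `S`. -/
def contractRel (S : Set Γ.E) : Γ.V → Γ.V → Prop :=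
  fun x y => ∃ e ∈ S, Γ.src e = x ∧ Γ.tgt e = y

/-- Contraction `Γ/S`: vertices in the same component of `(V, S)` are identified
and the edges of `S` are deleted. -/
def contract (S : Set Γ.E) : MGraph where
  V := Quot (Γ.contractRel S)
  E := {e : Γ.E // e ∉ S}
  src e := Quot.mk _ (Γ.src e.1)
  tgt e := Quot.mk _ (Γ.tgt e.1)

/-- The subgraph with vertex set `U` and edge set the edges of `T` having both
endpoints in `U`. -/
def subgraph (U : Set Γ.V) (T : Set Γ.E) : MGraph where
  V := U
  E := {e : Γ.E // e ∈ T ∧ Γ.src e ∈ U ∧ Γ.tgt e ∈ U}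
  src e := ⟨Γ.src e.1, e.2.2.1⟩
  tgt e := ⟨Γ.tgt e.1, e.2.2.2⟩

/-- The set of vertices incident with an edge of `D`. -/
def edgeVerts (D : Set Γ.E) : Set Γ.V := {x | ∃ e ∈ D, Γ.src e = x ∨ Γ.tgt e = x}

/-- The subgraph spanned by an edge set `D`. -/
def edgeSubgraph (D : Set Γ.E) : MGraph := Γ.subgraph (Γ.edgeVerts D) D

/-- Adjacency of vertices. -/
def Adj (x y : Γ.V) : Prop :=
  ∃ e : Γ.E, (Γ.src e = x ∧ Γ.tgt e = y) ∨ (Γ.src e = y ∧ Γ.tgt e = x)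

/-- A graph with no loops. -/
def Loopless : Prop := ∀ e : Γ.E, Γ.src e ≠ Γ.tgt e

/-- A finite graph. -/
def IsFiniteGraph : Prop := Finite Γ.V ∧ Finite Γ.E

/-- A graph is inseparable if any two distinct edges lie in a common circle. -/
def Inseparable : Prop :=
  ∀ e f : Γ.E, e ≠ f →
    ∃ (v : Γ.V) (l : List Γ.Step), Γ.IsWalkFrom v v l ∧ Γ.IsSimpleClosed l ∧
      e ∈ Γ.walkEdges l ∧ f ∈ Γ.walkEdges l

/-- `D` is (the edge set of) a block of `Γ`: a maximal inseparable subgraph. -/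
def IsBlock (D : Set Γ.E) : Prop :=
  (Γ.edgeSubgraph D).Inseparable ∧
  ∀ D', D ⊆ D' → (Γ.edgeSubgraph D').Inseparable → D' = D

/-- The edge set `D` is a circle of `Γ`. -/
def IsCircleSet (D : Set Γ.E) : Prop :=
  ∃ (v : Γ.V) (l : List Γ.Step), Γ.IsWalkFrom v v l ∧ Γ.IsSimpleClosed l ∧
    D = {e | e ∈ Γ.walkEdges l}

/-- The edge set `D` is a balanced circle for the gain function `g`. -/
def IsBalancedCircleSet {G : Type} [Group G] (g : Γ.E → G) (D : Set Γ.E) : Prop :=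
  Γ.IsCircleSet D ∧
  ∀ (v : Γ.V) (l : List Γ.Step), Γ.IsWalkFrom v v l → Γ.IsSimpleClosed l →
    D = {e | e ∈ Γ.walkEdges l} → Γ.walkGain g l = 1

end Walks

/-- An isomorphism of multigraphs (preserving endpoints as unordered pairs). -/
structure Iso (Γ Δ : MGraph) where
  vEquiv : Γ.V ≃ Δ.V
  eEquiv : Γ.E ≃ Δ.E
  ends_eq : ∀ e : Γ.E,
    s(Δ.src (eEquiv e), Δ.tgt (eEquiv e)) = s(vEquiv (Γ.src e), vEquiv (Γ.tgt e))

/-- `Δ` is a minor of `Γ`: `Δ` is isomorphic to a subgraph of a contraction of `Γ`. -/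
def IsMinor (Δ Γ : MGraph) : Prop :=
  ∃ (S : Set Γ.E) (U : Set (Γ.contract S).V) (T : Set (Γ.contract S).E),
    Nonempty (Iso Δ ((Γ.contract S).subgraph U T))

/-- Subdivision of the edge `e₀` into a path of length two. -/
def subdivide (Γ : MGraph) (e₀ : Γ.E) : MGraph where
  V := Γ.V ⊕ Unit
  E := Γ.E ⊕ Unit
  src := fun e => match e with
    | .inl e => Sum.inl (Γ.src e)
    | .inr _ => Sum.inr ()
  tgt := fun e => match e with
    | .inl e => if e = e₀ then Sum.inr () else Sum.inl (Γ.tgt e)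
    | .inr _ => Sum.inl (Γ.tgt e₀)

/-- One subdivision step (up to isomorphism). -/
def SubdivisionStep (A B : MGraph) : Prop :=
  Nonempty (Iso B A) ∨ ∃ e₀ : A.E, Nonempty (Iso B (A.subdivide e₀))

/-- `Δ` is (isomorphic to) a graph obtained from `Γ₀` by subdividing edges. -/
def IsSubdivisionOf (Δ Γ₀ : MGraph) : Prop :=
  ∃ Δ', Relation.ReflTransGen SubdivisionStep Γ₀ Δ' ∧ Nonempty (Iso Δ Δ')

/-- Two graphs are homeomorphic if both are obtained by subdividing edges of a
common graph. -/
def Homeomorphic (Γ₁ Γ₂ : MGraph) : Prop :=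
  ∃ Γ₀, IsSubdivisionOf Γ₁ Γ₀ ∧ IsSubdivisionOf Γ₂ Γ₀

section Ops

variable (Γ : MGraph)

/-- Interchange `u` and `v`. -/
def twistVert (u v x : Γ.V) : Γ.V := if x = u then v else if x = v then u else x

/-- The result of twisting the edge set `A` across `{u, v}`: every endpoint of an
edge of `A` at `u` is reconnected to `v` and vice versa. -/
def twist (u v : Γ.V) (A : Set Γ.E) : MGraph where
  V := Γ.V
  E := Γ.E
  src e := if e ∈ A then Γ.twistVert u v (Γ.src e) else Γ.src e
  tgt e := if e ∈ A then Γ.twistVert u v (Γ.tgt e) else Γ.tgt e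

/-- `x` and `y` are joined by a walk all of whose vertices avoid `u` and `v`. -/
def AvoidConn (u v x y : Γ.V) : Prop :=
  ∃ l, Γ.IsWalkFrom x y l ∧ ∀ z ∈ Γ.walkVerts x l, z ≠ u ∧ z ≠ v

/-- `P` is the vertex set of a union of some, but not all, of the components of
`Γ ∖ {u, v}` (the data of a Whitney twist across the 2-separation `{u,v}`). -/
def IsWhitneyTwistData (u v : Γ.V) (P : Set Γ.V) : Prop :=
  (∀ x ∈ P, x ≠ u ∧ x ≠ v) ∧
  (∀ x ∈ P, ∀ y, Γ.AvoidConn u v x y → y ∈ P) ∧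
  P.Nonempty ∧ (∃ y : Γ.V, y ∉ P ∧ y ≠ u ∧ y ≠ v)

/-- `(v, w, F)` is valid data for extruding the vertex `v`: `w` is a neighbor of
`v` and `F` is a nonempty set of edges joining `v` and `w`. -/
def IsExtrusionData (v w : Γ.V) (F : Set Γ.E) : Prop :=
  v ≠ w ∧ F.Nonempty ∧
  ∀ e ∈ F, (Γ.src e = v ∧ Γ.tgt e = w) ∨ (Γ.src e = w ∧ Γ.tgt e = v)

/-- Extrusion of a new vertex `v′` from `v`: the edges of `F` are reattached to
join `v′` to `w`, and a new edge joins `v` to `v′`. -/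
def extrude (v w : Γ.V) (F : Set Γ.E) : MGraph where
  V := Γ.V ⊕ Unit
  E := Γ.E ⊕ Unit
  src := fun e => match e with
    | .inl e => if e ∈ F ∧ Γ.src e = v then Sum.inr () else Sum.inl (Γ.src e)
    | .inr _ => Sum.inl v
  tgt := fun e => match e with
    | .inl e => if e ∈ F ∧ Γ.tgt e = v then Sum.inr () else Sum.inl (Γ.tgt e)
    | .inr _ => Sum.inr ()

end Ops

/-- `Δ` is obtained from `Γ` by extruding a vertex (up to isomorphism). -/
def IsExtrusionOf (Δ Γ : MGraph) : Prop :=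
  ∃ (v w : Γ.V) (F : Set Γ.E),
    Γ.IsExtrusionData v w F ∧ Nonempty (Iso Δ (Γ.extrude v w F))

/-- `Γ` is extrusion-irreducible: it is not obtainable by extrusion from a
smaller graph. -/
def ExtrusionIrreducible (Γ : MGraph) : Prop := ¬ ∃ Δ : MGraph, IsExtrusionOf Γ Δ

/-- `Δ` is obtained from `Γ₀` by a (possibly empty) sequence of extrusions,
up to isomorphism. -/
def ObtainedByExtrusions (Δ Γ₀ : MGraph) : Prop :=
  ∃ Δ', Relation.ReflTransGen (fun A B => IsExtrusionOf B A) Γ₀ Δ' ∧ Nonempty (Iso Δ Δ')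

section Bridges

variable (Γ : MGraph)

/-- The walk `l` is internally disjoint from `{u, v}`. -/
def IntDisjWalk (u v : Γ.V) (l : List Γ.Step) : Prop :=
  ∀ z ∈ (l.map Γ.stepEnd).dropLast, z ≠ u ∧ z ≠ v

/-- Two edges lie in a common walk internally disjoint from `{u, v}`. -/
def InBridgeRel (u v : Γ.V) (e f : Γ.E) : Prop :=
  ∃ (a b : Γ.V) (l : List Γ.Step), Γ.IsWalkFrom a b l ∧ Γ.IntDisjWalk u v l ∧
    e ∈ Γ.walkEdges l ∧ f ∈ Γ.walkEdges l

/-- `D` is (the edge set of) a bridge of `{u, v}`: a maximal set of edges any two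
of which lie in a common walk internally disjoint from `{u, v}`. -/
def IsBridge (u v : Γ.V) (D : Set Γ.E) : Prop :=
  D.Nonempty ∧ (∀ e ∈ D, ∀ f ∈ D, Γ.InBridgeRel u v e f) ∧
  ∀ D', D ⊆ D' → (∀ e ∈ D', ∀ f ∈ D', Γ.InBridgeRel u v e f) → D' = D

/-- The set `A` of vertices is connected using only edges of `D`, within `A`. -/
def SetConnWith (D : Set Γ.E) (A : Set Γ.V) : Prop :=
  ∀ x ∈ A, ∀ y ∈ A, ∃ l, Γ.IsWalkFrom x y l ∧ (∀ s ∈ l, s.1 ∈ D) ∧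
    ∀ z ∈ Γ.walkVerts x l, z ∈ A

/-- The subgraph with edge set `D` has `2P_{2uv}` (a four-circle with `u`, `v` as
opposite vertices) as a minor rooted at `u` and `v`, expressed by branch sets. -/
def HasRooted2P2Minor (u v : Γ.V) (D : Set Γ.E) : Prop :=
  ∃ β : Fin 4 → Set Γ.V,
    (∀ i j, i ≠ j → Disjoint (β i) (β j)) ∧
    (∀ i, (β i).Nonempty ∧ Γ.SetConnWith D (β i)) ∧
    u ∈ β 0 ∧ v ∈ β 2 ∧
    ∀ i : Fin 4, ∃ e ∈ D,
      (Γ.src e ∈ β i ∧ Γ.tgt e ∈ β (i + 1)) ∨ (Γ.src e ∈ β (i + 1) ∧ Γ.tgt e ∈ β i)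

/-- Removing the vertex `w` disconnects the subgraph with edge set `D`. -/
def SeparatesBridge (D : Set Γ.E) (w : Γ.V) : Prop :=
  ∃ x ∈ Γ.edgeVerts D, ∃ y ∈ Γ.edgeVerts D, x ≠ w ∧ y ≠ w ∧
    ¬ ∃ l, Γ.IsWalkFrom x y l ∧ (∀ s ∈ l, s.1 ∈ D) ∧ ∀ z ∈ Γ.walkVerts x l, z ≠ w

end Bridges

/-! ### Particular graphs -/

/-- `K₁°`: one vertex with one loop. -/
@[reducible] def loopGraph : MGraph where
  V := Unit
  E := Unit
  src _ := ()
  tgt _ := ()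

/-- `mK₂`: two vertices joined by `m` parallel edges. -/
@[reducible] def banana (m : ℕ) : MGraph where
  V := Bool
  E := Fin m
  src _ := false
  tgt _ := true

/-- `C_l(m₁, …, m_l)`: a circle of length `l` whose `i`-th edge is replaced by
`m i` parallel copies. -/
@[reducible] def multiCircle (l : ℕ) (m : Fin l → ℕ) : MGraph where
  V := Fin l
  E := Σ i : Fin l, Fin (m i)
  src e := e.1
  tgt e := ⟨(e.1.1 + 1) % l, Nat.mod_lt _ e.1.pos⟩

/-- `2C_n`: the circle of length `n` with every edge doubled. -/
@[reducible] def twoCircle (n : ℕ) : MGraph := multiCircle n fun _ => 2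

/-- `K₄(m, m′)`: `K₄` with two opposite (nonadjacent) edges replaced by `m` and
`m′` parallel copies respectively. -/
@[reducible] def K4m (m m' : ℕ) : MGraph where
  V := Fin 4
  E := (Fin m ⊕ Fin m') ⊕ Fin 4
  src := fun e => match e with
    | .inl (.inl _) => 0
    | .inl (.inr _) => 2
    | .inr j => ![0, 0, 1, 1] j
  tgt := fun e => match e with
    | .inl (.inl _) => 1
    | .inl (.inr _) => 3
    | .inr j => ![2, 3, 2, 3] j

/-- `K₄''`: `K₄` with two adjacent edges doubled. -/
@[reducible] def K4dd : MGraph where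
  V := Fin 4
  E := Fin 8
  src := ![0, 0, 0, 0, 0, 1, 1, 2]
  tgt := ![1, 1, 2, 2, 3, 2, 3, 3]

/-- The `n`-spoke wheel `W_n`: rim vertices `Fin n` and a hub; `inl i` is the rim
edge from `v_i` to `v_{i+1}` and `inr i` is the spoke from the hub to `v_i`. -/
@[reducible] def wheel (n : ℕ) : MGraph where
  V := Fin n ⊕ Unit
  E := Fin n ⊕ Fin n
  src := fun e => match e with
    | .inl i => Sum.inl i
    | .inr _ => Sum.inr ()
  tgt := fun e => match e with
    | .inl i => Sum.inl ⟨(i.1 + 1) % n, Nat.mod_lt _ i.pos⟩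
    | .inr i => Sum.inl i

instance (n : ℕ) : Finite ((wheel n).E) := inferInstanceAs (Finite (Fin n ⊕ Fin n))

/-- The indicator of an edge set, as a binary chain. -/
def indicatorCycle (Γ : MGraph) [Finite Γ.E] (D : Set Γ.E) : Γ.E →₀ ZMod 2 :=
  Finsupp.equivFunOnFinite.symm fun e => if e ∈ D then 1 else 0

/-- The edge set of the Hamiltonian circle of `W_n` omitting the rim edge `r`:
all rim edges except `r`, together with the two spokes at the ends of `r`. -/
def wheelHamSet (n : ℕ) (r : Fin n) : Set (wheel n).E :=
  {e | Sum.elim (fun j : Fin n => j ≠ r)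
      (fun j : Fin n => j = r ∨ j = ⟨(r.1 + 1) % n, Nat.mod_lt _ r.pos⟩) e}

/-- The set of (indicators of) the `n` Hamiltonian circles of the wheel `W_n`. -/
def wheelHamBasis (n : ℕ) : Set ((wheel n).E →₀ ZMod 2) :=
  {c | ∃ r : Fin n, c = indicatorCycle (wheel n) (wheelHamSet n r)}

/-- A theta graph: a graph homeomorphic to a triple link. -/
def IsThetaGraph (Δ : MGraph) : Prop := Homeomorphic Δ (banana 3)

end MGraph

end

namespace MGraph

/-! ### The homeomorphism invariant -/

/-- No four distinct darts leave a common vertex. -/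
def DegLe3 (Δ : MGraph) : Prop :=
  ∀ (w : Δ.V) (f : Fin 4 → Δ.Step), Function.Injective f → ¬ ∀ i, Δ.stepStart (f i) = w

/-- Finite, cyclomatic excess one, maximum degree at most three. -/
def ThetaInv (Δ : MGraph) : Prop :=
  Finite Δ.V ∧ Finite Δ.E ∧ Nat.card Δ.E = Nat.card Δ.V + 1 ∧ Δ.DegLe3

theorem degLe3_of_map {A B : MGraph} (φ : A.V → B.V) (F : A.Step → B.Step)
    (hF : Function.Injective F) (hs : ∀ s, B.stepStart (F s) = φ (A.stepStart s))
    (h : B.DegLe3) : A.DegLe3 := by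
  intro w f hf hw
  exact h (φ w) (F ∘ f) (hF.comp hf) (fun i => by simp [hs, hw])

def isoSymm {A B : MGraph} (i : Iso A B) : Iso B A where
  vEquiv := i.vEquiv.symm
  eEquiv := i.eEquiv.symm
  ends_eq e := by
    have := i.ends_eq (i.eEquiv.symm e)
    simp only [Equiv.apply_symm_apply] at this
    rw [Sym2.eq_iff] at this ⊢
    rcases this with ⟨h1, h2⟩ | ⟨h1, h2⟩
    · left; simp [h1, h2]
    · right; simp [h1, h2]

theorem degLe3_of_iso {A B : MGraph} (i : Iso A B) (h : B.DegLe3) : A.DegLe3 := by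
  refine degLe3_of_map i.vEquiv
    (fun s => (i.eEquiv s.1, if B.src (i.eEquiv s.1) = i.vEquiv (A.src s.1) then s.2 else !s.2))
    ?_ ?_ h
  · rintro ⟨e, b⟩ ⟨e', b'⟩ hh
    simp only [Prod.mk.injEq, EmbeddingLike.apply_eq_iff_eq] at hh
    obtain ⟨rfl, h2⟩ := hh
    split_ifs at h2 <;> simp_all
  · rintro ⟨e, b⟩
    have := i.ends_eq e
    rw [Sym2.eq_iff] at this
    by_cases h0 : B.src (i.eEquiv e) = i.vEquiv (A.src e)
    · have h1 : B.tgt (i.eEquiv e) = i.vEquiv (A.tgt e) := by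
        rcases this with ⟨h1, h2⟩ | ⟨h1, h2⟩
        · exact h2
        · rw [h2, ← h0, h1]
      cases b <;> simp [stepStart, h0, h1]
    · rcases this with ⟨h1, h2⟩ | ⟨h1, h2⟩
      · exact absurd h1 h0
      · cases b <;> simp [stepStart, h0, h1, h2] <;> simp_all

theorem thetaInv_of_iso {A B : MGraph} (i : Iso A B) (h : B.ThetaInv) : A.ThetaInv := by
  obtain ⟨h1, h2, h3, h4⟩ := h
  refine ⟨Finite.of_equiv _ i.vEquiv.symm, Finite.of_equiv _ i.eEquiv.symm, ?_, degLe3_of_iso i h4⟩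
  rw [Nat.card_congr i.vEquiv, Nat.card_congr i.eEquiv, h3]

theorem thetaInv_iso_iff {A B : MGraph} (i : Iso A B) : A.ThetaInv ↔ B.ThetaInv :=
  ⟨thetaInv_of_iso (isoSymm i), thetaInv_of_iso i⟩

/-- Darts of `A` as darts of the subdivision. -/
noncomputable def subMap (A : MGraph) (e₀ : A.E) (s : A.Step) : (A.subdivide e₀).Step :=
  if s = (e₀, false) then (Sum.inr (), false) else (Sum.inl s.1, s.2)

theorem subMap_inj (A : MGraph) (e₀ : A.E) : Function.Injective (subMap A e₀) := by
  intro s t h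
  unfold subMap at h
  split_ifs at h with h1 h2 h2
  · rw [h1, h2]
  · exact absurd (congrArg Prod.fst h) Sum.inr_ne_inl
  · exact absurd (congrArg Prod.fst h) Sum.inl_ne_inr
  · have hb := congrArg Prod.snd h
    exact Prod.ext (Sum.inl.inj (congrArg Prod.fst h)) hb

theorem subMap_start (A : MGraph) (e₀ : A.E) (s : A.Step) :
    (A.subdivide e₀).stepStart (subMap A e₀ s) = Sum.inl (A.stepStart s) := by
  obtain ⟨e, b⟩ := s
  cases b <;> by_cases h : e = e₀ <;> simp [subMap, stepStart, subdivide, h]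

theorem subMap_surj (A : MGraph) (e₀ : A.E) (t : (A.subdivide e₀).Step) (v : A.V)
    (h : (A.subdivide e₀).stepStart t = Sum.inl v) : ∃ s, subMap A e₀ s = t := by
  obtain ⟨e | u, b⟩ := t
  · refine ⟨(e, b), ?_⟩
    unfold subMap
    rw [if_neg]
    rintro h'
    simp only [Prod.mk.injEq] at h'
    obtain ⟨rfl, rfl⟩ := h'
    simp [stepStart, subdivide] at h
  · cases b
    · exact ⟨(e₀, false), by simp [subMap]⟩
    · simp [stepStart, subdivide] at h

theorem sub_inr (A : MGraph) (e₀ : A.E) (t : (A.subdivide e₀).Step)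
    (h : (A.subdivide e₀).stepStart t = Sum.inr ()) :
    t = (Sum.inl e₀, false) ∨ t = (Sum.inr (), true) := by
  obtain ⟨e | u, b⟩ := t
  · left
    cases b
    · by_cases he : e = e₀
      · subst he; rfl
      · simp [stepStart, subdivide, he] at h
    · simp [stepStart, subdivide] at h
  · right
    cases b
    · simp [stepStart, subdivide] at h
    · rfl

theorem degLe3_subdivide (A : MGraph) (e₀ : A.E) : A.DegLe3 ↔ (A.subdivide e₀).DegLe3 := by
  constructor
  · intro h w f hf hw
    rcases w with v | u
    · choose k hk using fun i => subMap_surj A e₀ (f i) v (hw i)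
      refine h v k ?_ ?_
      · intro i j hij
        apply hf
        rw [← hk, ← hk, hij]
      · intro i
        have := subMap_start A e₀ (k i)
        rw [hk, hw i] at this
        exact (Sum.inl.inj this).symm
    · have h0 := sub_inr A e₀ _ (hw 0)
      have h1 := sub_inr A e₀ _ (hw 1)
      have h2 := sub_inr A e₀ _ (hw 2)
      have n01 : f 0 ≠ f 1 := fun h => absurd (hf h) (by decide)
      have n02 : f 0 ≠ f 2 := fun h => absurd (hf h) (by decide)
      have n12 : f 1 ≠ f 2 := fun h => absurd (hf h) (by decide)
      rcases h0 with h0 | h0 <;> rcases h1 with h1 | h1 <;> rcases h2 with h2 | h2 <;>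
        first
          | exact n01 (h0.trans h1.symm)
          | exact n02 (h0.trans h2.symm)
          | exact n12 (h1.trans h2.symm)
  · exact degLe3_of_map Sum.inl (subMap A e₀) (subMap_inj A e₀) (subMap_start A e₀)

theorem thetaInv_subdivide (A : MGraph) (e₀ : A.E) :
    A.ThetaInv ↔ (A.subdivide e₀).ThetaInv := by
  unfold ThetaInv
  rw [← degLe3_subdivide]
  constructor
  · rintro ⟨h1, h2, h3, h4⟩
    refine ⟨inferInstanceAs (Finite (A.V ⊕ Unit)), inferInstanceAs (Finite (A.E ⊕ Unit)), ?_, h4⟩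
    change Nat.card (A.E ⊕ Unit) = Nat.card (A.V ⊕ Unit) + 1
    rw [Nat.card_sum, Nat.card_sum, h3]; simp
  · rintro ⟨h1, h2, h3, h4⟩
    have h1' : Finite (A.V ⊕ Unit) := h1
    have h2' : Finite (A.E ⊕ Unit) := h2
    have f1 : Finite A.V := Finite.of_injective (Sum.inl : A.V → A.V ⊕ Unit) Sum.inl_injective
    have f2 : Finite A.E := Finite.of_injective (Sum.inl : A.E → A.E ⊕ Unit) Sum.inl_injective
    refine ⟨f1, f2, ?_, h4⟩
    change Nat.card (A.E ⊕ Unit) = Nat.card (A.V ⊕ Unit) + 1 at h3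
    rw [Nat.card_sum, Nat.card_sum] at h3
    simp at h3
    omega

theorem thetaInv_subdivisionOf {A B : MGraph} (h : IsSubdivisionOf B A) :
    B.ThetaInv ↔ A.ThetaInv := by
  obtain ⟨D, hD, ⟨i⟩⟩ := h
  rw [thetaInv_iso_iff i]
  clear i
  induction hD with
  | refl => rfl
  | tail _ hs ih =>
    rw [← ih]
    rcases hs with ⟨⟨i⟩⟩ | ⟨e, ⟨i⟩⟩
    · exact thetaInv_iso_iff i
    · rw [thetaInv_iso_iff i, ← thetaInv_subdivide]

theorem thetaInv_banana : (banana 3).ThetaInv := by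
  refine ⟨inferInstanceAs (Finite Bool), inferInstanceAs (Finite (Fin 3)), ?_, ?_⟩
  · change Nat.card (Fin 3) = Nat.card Bool + 1
    simp
  · intro w f hf hw
    have hb : ∀ i, (f i).2 = !w := by
      intro i
      have := hw i
      simp only [stepStart] at this
      cases h : (f i).2 <;> rw [h] at this <;> simp at this <;> rw [this] <;> rfl
    have hi : Function.Injective (fun i => ((f i).1 : Fin 3)) := by
      intro i j hij
      exact hf (Prod.ext hij ((hb i).trans (hb j).symm))
    have := Fintype.card_le_of_injective _ hi
    simp at this

theorem thetaInv_of_theta {Δ : MGraph} (h : IsThetaGraph Δ) : Δ.ThetaInv := by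
  obtain ⟨Γ₀, h1, h2⟩ := h
  rw [thetaInv_subdivisionOf h1, ← thetaInv_subdivisionOf h2]
  exact thetaInv_banana

/-! ### Walks -/

variable {Γ : MGraph}

theorem walk_append {a b c : Γ.V} {l m : List Γ.Step} (h : Γ.IsWalkFrom a b l)
    (h' : Γ.IsWalkFrom b c m) : Γ.IsWalkFrom a c (l ++ m) := by
  induction h with
  | nil => exact h'
  | cons hs _ ih => exact .cons hs (ih h')

theorem walk_split {a c : Γ.V} {l m : List Γ.Step} (h : Γ.IsWalkFrom a c (l ++ m)) :
    ∃ b, Γ.IsWalkFrom a b l ∧ Γ.IsWalkFrom b c m := by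
  induction l generalizing a with
  | nil => exact ⟨a, .nil a, h⟩
  | cons s l ih =>
    cases h with
    | cons hs hw =>
      obtain ⟨b, h1, h2⟩ := ih hw
      exact ⟨b, .cons hs h1, h2⟩

theorem walk_verts {a b : Γ.V} {l : List Γ.Step} (h : Γ.IsWalkFrom a b l) :
    a :: l.map Γ.stepEnd = l.map Γ.stepStart ++ [b] := by
  induction h with
  | nil => rfl
  | cons hs _ ih => simp [← hs, ih]

def flipStep (s : Γ.Step) : Γ.Step := (s.1, !s.2)

theorem start_flip (s : Γ.Step) : Γ.stepStart (flipStep s) = Γ.stepEnd s := by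
  obtain ⟨e, b⟩ := s
  cases b <;> rfl

theorem end_flip (s : Γ.Step) : Γ.stepEnd (flipStep s) = Γ.stepStart s := by
  obtain ⟨e, b⟩ := s
  cases b <;> rfl

def revWalk (l : List Γ.Step) : List Γ.Step := (l.map flipStep).reverse

theorem walk_rev {a b : Γ.V} {l : List Γ.Step} (h : Γ.IsWalkFrom a b l) :
    Γ.IsWalkFrom b a (revWalk l) := by
  induction h with
  | nil => exact .nil _
  | @cons a b s l hs _ ih =>
    have : revWalk (s :: l) = revWalk l ++ [flipStep s] := by simp [revWalk]
    rw [this]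
    refine walk_append ih (.cons (start_flip s) ?_)
    rw [end_flip, hs]
    exact .nil _

theorem rev_edges (l : List Γ.Step) : Γ.walkEdges (revWalk l) = (Γ.walkEdges l).reverse := by
  simp [walkEdges, revWalk, flipStep, Function.comp_def]

theorem rev_starts (l : List Γ.Step) :
    (revWalk l).map Γ.stepStart = (l.map Γ.stepEnd).reverse := by
  simp [revWalk, Function.comp_def, start_flip]

theorem start_mem_edgeVerts {D : Set Γ.E} {s : Γ.Step} (h : s.1 ∈ D) :
    Γ.stepStart s ∈ Γ.edgeVerts D := by
  obtain ⟨e, b⟩ := s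
  cases b
  · exact ⟨e, h, Or.inr rfl⟩
  · exact ⟨e, h, Or.inl rfl⟩

theorem end_mem_edgeVerts {D : Set Γ.E} {s : Γ.Step} (h : s.1 ∈ D) :
    Γ.stepEnd s ∈ Γ.edgeVerts D := by
  rw [← start_flip]; exact start_mem_edgeVerts (s := flipStep s) h

theorem closed_end_mem {v : Γ.V} {l : List Γ.Step} (h : Γ.IsWalkFrom v v l) (x : Γ.V) :
    x ∈ l.map Γ.stepEnd ↔ x ∈ l.map Γ.stepStart := by
  have hp : (v :: l.map Γ.stepEnd).Perm (v :: l.map Γ.stepStart) := by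
    rw [walk_verts h]
    exact List.perm_append_singleton _ _
  exact ((List.perm_cons v).1 hp).mem_iff

theorem edgeVerts_closed {v : Γ.V} {l : List Γ.Step} (h : Γ.IsWalkFrom v v l) :
    Γ.edgeVerts {e | e ∈ Γ.walkEdges l} = {x | x ∈ l.map Γ.stepStart} := by
  ext x
  constructor
  · rintro ⟨e, he, hx⟩
    simp only [walkEdges, Set.mem_ofPred_eq, List.mem_map] at he
    obtain ⟨s, hs, rfl⟩ := he
    have hor : x = Γ.stepStart s ∨ x = Γ.stepEnd s := by
      obtain ⟨e, b⟩ := s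
      cases b <;> simp [stepStart, stepEnd] <;> tauto
    rcases hor with rfl | rfl
    · exact List.mem_map_of_mem hs
    · exact (closed_end_mem h _).1 (List.mem_map_of_mem hs)
  · intro hx
    simp only [Set.mem_ofPred_eq, List.mem_map] at hx
    obtain ⟨s, hs, rfl⟩ := hx
    exact start_mem_edgeVerts (List.mem_map_of_mem hs)

/-! ### Gains and potentials -/

section Gains

variable {G : Type} [Group G] {g : Γ.E → G}

theorem gain_append (l m : List Γ.Step) :
    Γ.walkGain g (l ++ m) = Γ.walkGain g l * Γ.walkGain g m := by
  simp [walkGain]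

theorem gain_cons (s : Γ.Step) (m : List Γ.Step) :
    Γ.walkGain g (s :: m) = Γ.stepGain g s * Γ.walkGain g m := by
  simp [walkGain]

/-- `φ` is a potential for the edge `e`. -/
def PotOn (g : Γ.E → G) (φ : Γ.V → G) (e : Γ.E) : Prop := φ (Γ.tgt e) = φ (Γ.src e) * g e

theorem potOn_step {φ : Γ.V → G} (s : Γ.Step) :
    PotOn g φ s.1 ↔ φ (Γ.stepEnd s) = φ (Γ.stepStart s) * Γ.stepGain g s := by
  obtain ⟨e, b⟩ := s
  cases b
  · simp only [PotOn, stepEnd, stepStart, stepGain]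
    simp only [Bool.false_eq_true, if_false]
    rw [eq_mul_inv_iff_mul_eq, eq_comm]
  · simp [PotOn, stepEnd, stepStart, stepGain]

theorem pot_walk {φ : Γ.V → G} {a b : Γ.V} {l : List Γ.Step} (h : Γ.IsWalkFrom a b l)
    (hp : ∀ s ∈ l, PotOn g φ s.1) : φ b = φ a * Γ.walkGain g l := by
  induction h with
  | nil => simp [walkGain]
  | @cons a b s l hs _ ih =>
    rw [ih (fun t ht => hp t (List.mem_cons_of_mem _ ht)),
      (potOn_step s).1 (hp s List.mem_cons_self), gain_cons, hs, mul_assoc]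

theorem pot_path {a b : Γ.V} {l : List Γ.Step} (h : Γ.IsWalkFrom a b l)
    (hn : (a :: l.map Γ.stepEnd).Nodup) (c : G) :
    ∃ φ : Γ.V → G, φ a = c ∧ ∀ s ∈ l, PotOn g φ s.1 := by
  induction h generalizing c with
  | nil => exact ⟨fun _ => c, rfl, by simp⟩
  | @cons a b s l hs hw ih =>
    rw [List.map_cons, List.nodup_cons] at hn
    obtain ⟨φ, h1, h2⟩ := ih hn.2 (c * Γ.stepGain g s)
    have hna : ∀ x ∈ Γ.stepEnd s :: l.map Γ.stepEnd, Function.update φ a c x = φ x := by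
      intro x hx
      rw [Function.update_of_ne]
      rintro rfl
      exact hn.1 hx
    refine ⟨Function.update φ a c, by simp, ?_⟩
    intro t ht
    rcases List.mem_cons.1 ht with rfl | ht
    · rw [potOn_step, hna _ List.mem_cons_self, h1, hs]; simp
    · rw [potOn_step]
      have e1 := hna (Γ.stepEnd t) (List.mem_cons_of_mem _ (List.mem_map_of_mem ht))
      have e2 := hna (Γ.stepStart t) (by
        rw [walk_verts hw]
        exact List.mem_append_left _ (List.mem_map_of_mem ht))
      rw [e1, e2]
      exact (potOn_step t).1 (h2 t ht)

theorem pot_closed {v : Γ.V} {l : List Γ.Step} (h : Γ.IsWalkFrom v v l)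
    (hs : Γ.IsSimpleClosed l) (hg : Γ.walkGain g l = 1) :
    ∃ φ : Γ.V → G, ∀ e ∈ Γ.walkEdges l, PotOn g φ e := by
  obtain ⟨-, -, hn⟩ := hs
  cases h with
  | nil => exact ⟨fun _ => 1, by simp [walkEdges]⟩
  | @cons _ _ s l hst hw =>
    have hn' : (Γ.stepEnd s :: l.map Γ.stepEnd).Nodup := by
      rw [walk_verts hw, ← hst]
      exact (List.perm_append_singleton _ _).nodup_iff.2 hn
    obtain ⟨φ, -, h2⟩ := pot_path (g := g) hw hn' 1
    refine ⟨φ, ?_⟩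
    intro e he
    simp only [walkEdges, List.mem_map] at he
    obtain ⟨t, ht, rfl⟩ := he
    rcases List.mem_cons.1 ht with rfl | ht
    · rw [potOn_step, hst]
      have := pot_walk hw h2
      rw [this, mul_assoc]
      rw [gain_cons] at hg
      rw [mul_eq_one_iff_eq_inv.1 hg]
      simp
    · exact h2 t ht

theorem balanced_of_pot {D : Set Γ.E} (hD : Γ.IsCircleSet D) (φ : Γ.V → G)
    (hφ : ∀ e ∈ D, PotOn g φ e) : Γ.IsBalancedCircleSet g D := by
  refine ⟨hD, ?_⟩
  rintro v l hw - rfl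
  have := pot_walk hw (fun s hs => hφ s.1 (List.mem_map_of_mem hs))
  exact (mul_eq_left.1 this.symm)

theorem pot_of_balanced {D : Set Γ.E} (h : Γ.IsBalancedCircleSet g D) :
    ∃ φ : Γ.V → G, ∀ e ∈ D, PotOn g φ e := by
  obtain ⟨⟨v, l, hw, hs, rfl⟩, hb⟩ := h
  exact pot_closed hw hs (hb v l hw hs rfl)

end Gains

/-! ### Boundary -/

theorem walk_boundary {a b : Γ.V} {l : List Γ.Step} (h : Γ.IsWalkFrom a b l) :
    ((Γ.walkEdges l).map fun e =>
      (Finsupp.single (Γ.src e) 1 + Finsupp.single (Γ.tgt e) 1 : Γ.V →₀ ZMod 2)).sum =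
      Finsupp.single a 1 + Finsupp.single b 1 := by
  have two : ∀ x : Γ.V →₀ ZMod 2, x + x = 0 := fun x => by
    ext i; simp; exact CharTwo.add_self_eq_zero _
  induction h with
  | nil => simp [walkEdges, two]
  | @cons a b s l hs _ ih =>
    have e : (Finsupp.single (Γ.src s.1) 1 + Finsupp.single (Γ.tgt s.1) 1 : Γ.V →₀ ZMod 2) =
        Finsupp.single a 1 + Finsupp.single (Γ.stepEnd s) 1 := by
      rw [← hs]
      obtain ⟨e, b⟩ := s
      cases b
      · simp [stepStart, stepEnd, add_comm]
      · simp [stepStart, stepEnd]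
    simp only [walkEdges, List.map_cons, List.sum_cons] at ih ⊢
    rw [ih, e, add_assoc, ← add_assoc (Finsupp.single (Γ.stepEnd s) 1), two, zero_add]

theorem ends_eq_of_boundary {V : Type} {a b c d : V} (hab : a ≠ b)
    (h : (Finsupp.single a 1 + Finsupp.single b 1 : V →₀ ZMod 2) =
      Finsupp.single c 1 + Finsupp.single d 1) : (a = c ∧ b = d) ∨ (a = d ∧ b = c) := by
  have ha := DFunLike.congr_fun h a
  have hb := DFunLike.congr_fun h b
  simp only [Finsupp.add_apply, Finsupp.single_apply] at ha hb
  by_cases h1 : c = a <;> by_cases h2 : d = a <;> by_cases h3 : c = b <;> by_cases h4 : d = b <;>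
    simp_all

/-! ### Decomposition of a circle -/

theorem split_aux {E₂ : Set Γ.E} {a b : Γ.V} {l : List Γ.Step} (h : Γ.IsWalkFrom a b l)
    (hl : ∀ s ∈ l, Γ.stepStart s ∈ Γ.edgeVerts E₂ → s.1 ∈ E₂) (ha : a ∈ Γ.edgeVerts E₂) :
    ∀ s ∈ l, s.1 ∈ E₂ := by
  induction h with
  | nil => simp
  | @cons a b s l hs _ ih =>
    have h1 : s.1 ∈ E₂ := hl s List.mem_cons_self (hs ▸ ha)
    intro t ht
    rcases List.mem_cons.1 ht with rfl | ht
    · exact h1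
    · exact ih (fun t ht => hl t (List.mem_cons_of_mem _ ht)) (end_mem_edgeVerts h1) t ht

theorem split_walk {E₂ : Set Γ.E} {a b : Γ.V} {l : List Γ.Step} (h : Γ.IsWalkFrom a b l)
    (hl : ∀ s ∈ l, Γ.stepStart s ∈ Γ.edgeVerts E₂ → s.1 ∈ E₂) (hb : b ∈ Γ.edgeVerts E₂) :
    ∃ q p c, l = q ++ p ∧ Γ.IsWalkFrom a c q ∧ Γ.IsWalkFrom c b p ∧
      (∀ s ∈ q, Γ.stepStart s ∉ Γ.edgeVerts E₂) ∧ ∀ s ∈ p, s.1 ∈ E₂ := by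
  induction h with
  | nil v => exact ⟨[], [], v, rfl, .nil v, .nil v, by simp, by simp⟩
  | @cons a b s l hs hw ih =>
    by_cases ha : a ∈ Γ.edgeVerts E₂
    · exact ⟨[], s :: l, a, rfl, .nil a, .cons hs hw, by simp, split_aux (.cons hs hw) hl ha⟩
    · obtain ⟨q, p, c, h1, h2, h3, h4, h5⟩ :=
        ih (fun t ht => hl t (List.mem_cons_of_mem _ ht)) hb
      refine ⟨s :: q, p, c, by rw [h1]; rfl, .cons hs h2, h3, ?_, h5⟩
      intro t ht
      rcases List.mem_cons.1 ht with rfl | ht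
      · rwa [hs]
      · exact h4 t ht

theorem decompose {E₂ : Set Γ.E} {v : Γ.V} {l : List Γ.Step} (h : Γ.IsWalkFrom v v l)
    (hs : Γ.IsSimpleClosed l)
    (hc : l.countP (fun s => decide (Γ.stepStart s ∈ Γ.edgeVerts E₂ ∧ s.1 ∉ E₂)) = 1) :
    ∃ a b Q P, Γ.IsWalkFrom a b Q ∧ Γ.IsWalkFrom b a P ∧ Γ.IsSimpleClosed (Q ++ P) ∧
      (∀ e, e ∈ Γ.walkEdges l ↔ e ∈ Γ.walkEdges (Q ++ P)) ∧ Q ≠ [] ∧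
      (∀ s ∈ Q, s.1 ∉ E₂) ∧ (∀ s ∈ P, s.1 ∈ E₂) ∧
      (∀ s ∈ Q, Γ.stepStart s ∈ Γ.edgeVerts E₂ → Γ.stepStart s = a) := by
  obtain ⟨s₀, hs₀, hp⟩ := List.countP_pos_iff.1 (by rw [hc]; exact one_pos)
  obtain ⟨l₁, l₂, rfl⟩ := List.append_of_mem hs₀
  have hp' := of_decide_eq_true hp
  obtain ⟨c, w1, w2⟩ := walk_split h
  have perm : (l₁ ++ s₀ :: l₂).Perm (s₀ :: (l₂ ++ l₁)) := by
    have : (l₁ ++ s₀ :: l₂).Perm (s₀ :: l₂ ++ l₁) := List.perm_append_comm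
    exact this
  rw [perm.countP_eq, List.countP_cons, if_pos hp] at hc
  have hc0 := List.countP_eq_zero.1 (Nat.succ.inj hc)
  cases w2 with
  | cons hst w2 =>
    subst hst
    have hrest : ∀ s ∈ l₂ ++ l₁, Γ.stepStart s ∈ Γ.edgeVerts E₂ → s.1 ∈ E₂ := by
      intro s hs h1
      by_contra h2
      exact hc0 s hs (decide_eq_true ⟨h1, h2⟩)
    obtain ⟨q, p, c, h1, h2, h3, h4, h5⟩ := split_walk (walk_append w2 w1) hrest hp'.1
    rw [h1] at perm
    refine ⟨Γ.stepStart s₀, c, s₀ :: q, p, .cons rfl h2, h3, ⟨by simp, ?_, ?_⟩, ?_, by simp,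
      ?_, h5, ?_⟩
    · exact (perm.map Prod.fst).nodup_iff.1 hs.2.1
    · exact (perm.map Γ.stepStart).nodup_iff.1 hs.2.2
    · intro e
      exact (perm.map Prod.fst).mem_iff
    · intro s hs
      rcases List.mem_cons.1 hs with rfl | hs
      · exact hp'.2
      · exact fun hh => h4 s hs (start_mem_edgeVerts hh)
    · intro s hs hh
      rcases List.mem_cons.1 hs with rfl | hs
      · rfl
      · exact absurd hh (h4 s hs)

/-! ### Counting -/

theorem ncard_list {α β : Type} (l : List α) (f : α → β) (hn : (l.map f).Nodup) (S : Set β) :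
    ({x | x ∈ l.map f} ∩ S).ncard = l.countP (fun s => decide (f s ∈ S)) := by
  have h1 : ({x | x ∈ l.map f} ∩ S) =
      (((l.map f).filter (fun x => decide (x ∈ S))).toFinset : Set β) := by
    ext x; simp
  rw [h1, Set.ncard_coe_finset, List.toFinset_card_of_nodup (hn.filter _), ← List.countP_eq_length_filter,
    List.countP_map]
  rfl

theorem countP_split {α : Type} (l : List α) (p q : α → Prop) (h : ∀ s ∈ l, q s → p s) :
    l.countP (fun s => decide (p s)) =
      l.countP (fun s => decide (q s)) + l.countP (fun s => decide (p s ∧ ¬ q s)) := by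
  induction l with
  | nil => rfl
  | cons s l ih =>
    have := ih (fun t ht => h t (List.mem_cons_of_mem _ ht))
    have h0 := h s List.mem_cons_self
    simp only [List.countP_cons, this]
    by_cases hp : p s <;> by_cases hq : q s <;> simp_all <;> omega

theorem two_darts {v : Γ.V} {l : List Γ.Step} (h : Γ.IsWalkFrom v v l)
    (hs : Γ.IsSimpleClosed l) {x : Γ.V} (hx : x ∈ l.map Γ.stepStart) :
    ∃ s t : Γ.Step, s ≠ t ∧ s.1 ∈ Γ.walkEdges l ∧ t.1 ∈ Γ.walkEdges l ∧
      Γ.stepStart s = x ∧ Γ.stepStart t = x := by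
  have hx' := (closed_end_mem h x).2 hx
  obtain ⟨s, hsl, rfl⟩ := List.mem_map.1 hx
  obtain ⟨t, htl, ht⟩ := List.mem_map.1 hx'
  refine ⟨s, flipStep t, ?_, List.mem_map_of_mem hsl, List.mem_map.2 ⟨t, htl, rfl⟩,
    rfl, by rw [start_flip, ht]⟩
  intro heq
  have hst : s = t := List.inj_on_of_nodup_map hs.2.1 hsl htl (by rw [heq]; rfl)
  subst hst
  have := congrArg Prod.snd heq
  simp [flipStep] at this

theorem edgeVerts_union (A B : Set Γ.E) :
    Γ.edgeVerts (A ∪ B) = Γ.edgeVerts A ∪ Γ.edgeVerts B := by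
  ext x
  constructor
  · rintro ⟨e, he | he, hx⟩
    · exact Or.inl ⟨e, he, hx⟩
    · exact Or.inr ⟨e, he, hx⟩
  · rintro (⟨e, he, hx⟩ | ⟨e, he, hx⟩)
    · exact ⟨e, Or.inl he, hx⟩
    · exact ⟨e, Or.inr he, hx⟩

theorem no_four_darts {D : Set Γ.E} (h : (Γ.edgeSubgraph D).DegLe3) (x : Γ.V)
    (f : Fin 4 → Γ.Step) (hf : Function.Injective f) (hD : ∀ i, (f i).1 ∈ D)
    (hx : ∀ i, Γ.stepStart (f i) = x) : False := by
  have hxv : x ∈ Γ.edgeVerts D := hx 0 ▸ start_mem_edgeVerts (hD 0)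
  refine h ⟨x, hxv⟩ (fun i => (⟨(f i).1, hD i, ⟨_, hD i, Or.inl rfl⟩, ⟨_, hD i, Or.inr rfl⟩⟩,
    (f i).2)) ?_ ?_
  · intro i j hij
    have ha := congrArg Prod.fst hij
    have hb := congrArg Prod.snd hij
    exact hf (Prod.ext (congrArg Subtype.val ha) hb)
  · intro i
    have := hx i
    apply Subtype.ext
    simp only [stepStart] at this ⊢
    cases hb : (f i).2
    · rw [hb] at this; simpa [edgeSubgraph, subgraph] using this
    · rw [hb] at this; simpa [edgeSubgraph, subgraph] using this

theorem countP_exit {v : Γ.V} {l : List Γ.Step} (h : Γ.IsWalkFrom v v l)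
    (hs : Γ.IsSimpleClosed l) (D : Set Γ.E) :
    (Γ.edgeVerts {e | e ∈ Γ.walkEdges l} ∩ Γ.edgeVerts D).ncard =
      ({e | e ∈ Γ.walkEdges l} ∩ D).ncard +
      l.countP (fun s => decide (Γ.stepStart s ∈ Γ.edgeVerts D ∧ s.1 ∉ D)) := by
  rw [edgeVerts_closed h, ncard_list l Γ.stepStart hs.2.2]
  have : ({e | e ∈ Γ.walkEdges l} ∩ D).ncard = l.countP (fun s => decide (s.1 ∈ D)) :=
    ncard_list l Prod.fst hs.2.1 D
  rw [this]
  exact countP_split l (fun s => Γ.stepStart s ∈ Γ.edgeVerts D) (fun s => s.1 ∈ D)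
    (fun s _ h => start_mem_edgeVerts h)

theorem ncard_closed {v : Γ.V} {l : List Γ.Step} (h : Γ.IsWalkFrom v v l)
    (hs : Γ.IsSimpleClosed l) :
    (Γ.edgeVerts {e | e ∈ Γ.walkEdges l}).ncard = ({e | e ∈ Γ.walkEdges l}).ncard := by
  rw [edgeVerts_closed h]
  have h1 := ncard_list l Γ.stepStart hs.2.2 Set.univ
  have h2 : ({e | e ∈ Γ.walkEdges l} ∩ Set.univ).ncard = _ :=
    ncard_list l Prod.fst hs.2.1 Set.univ
  rw [Set.inter_univ] at h1 h2
  rw [h1, h2]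
  simp

theorem P_nodup {a b : Γ.V} {Q P : List Γ.Step} (hQ : Γ.IsWalkFrom a b Q)
    (hP : Γ.IsWalkFrom b a P) (hs : Γ.IsSimpleClosed (Q ++ P)) (hne : P ≠ []) (hq : Q ≠ []) :
    a ≠ b ∧ (Q.map Γ.stepEnd).Nodup ∧ a ∉ Q.map Γ.stepEnd := by
  have hn := hs.2.2
  rw [List.map_append, List.nodup_append] at hn
  have hb : b ∈ P.map Γ.stepStart := by
    cases hP with
    | nil => exact absurd rfl hne
    | cons h _ => simp [h]
  have ha : a ∈ Q.map Γ.stepStart := by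
    cases hQ with
    | nil => exact absurd rfl hq
    | cons h _ => simp [h]
  have hv : (a :: Q.map Γ.stepEnd).Nodup := by
    rw [walk_verts hQ]
    refine (List.perm_append_singleton _ _).nodup_iff.2 (List.nodup_cons.2 ⟨?_, hn.1⟩)
    intro h
    exact hn.2.2 b h b hb rfl
  rw [List.nodup_cons] at hv
  exact ⟨hn.2.2 a ha b hb, hv.2, hv.1⟩

theorem logic_inter {A B q p q' p' : Prop} (h1 : A ↔ q ∨ p) (h2 : B ↔ q' ∨ p') (h3 : q → ¬ B)
    (h4 : q' → ¬ A) (h5 : p → B) (h6 : p' → A) : p ↔ p' := by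
  tauto

theorem logic_symm {A B q p q' p' : Prop} (h1 : A ↔ q ∨ p) (h2 : B ↔ q' ∨ p') (h3 : q → ¬ B)
    (h4 : q' → ¬ A) (h5 : p → B) (h6 : p' → A) : (A ∧ ¬ B ∨ B ∧ ¬ A) ↔ q ∨ q' := by
  tauto

end MGraph

open MGraph in
/-- If `C₁` and `C₂` are balanced circles in a gain graph and
`C₁ ∪ C₂` is a theta graph, then the symmetric difference `C₁ + C₂` is a
balanced circle. -/
theorem theta_sum_balanced (Γ : MGraph) (G : Type) [Group G] (g : Γ.E → G)
    (C₁ C₂ : Set Γ.E)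
    (h₁ : Γ.IsBalancedCircleSet g C₁) (h₂ : Γ.IsBalancedCircleSet g C₂)
    (hθ : MGraph.IsThetaGraph (Γ.edgeSubgraph (C₁ ∪ C₂))) :
    Γ.IsBalancedCircleSet g (symmDiff C₁ C₂) := by
  obtain ⟨-, -, hcard, hdeg⟩ := thetaInv_of_theta hθ
  obtain ⟨φ, hφ⟩ := pot_of_balanced h₁
  obtain ⟨⟨v₁, l₁, w₁, s₁, e₁⟩, b₁⟩ := h₁
  obtain ⟨⟨v₂, l₂, w₂, s₂, e₂⟩, b₂⟩ := h₂
  -- counting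
  have cV : Nat.card (Γ.edgeSubgraph (C₁ ∪ C₂)).V = (Γ.edgeVerts C₁ ∪ Γ.edgeVerts C₂).ncard := by
    rw [← edgeVerts_union]; rfl
  have cE : Nat.card (Γ.edgeSubgraph (C₁ ∪ C₂)).E = (C₁ ∪ C₂).ncard := by
    have : {e | e ∈ C₁ ∪ C₂ ∧ Γ.src e ∈ Γ.edgeVerts (C₁ ∪ C₂) ∧
        Γ.tgt e ∈ Γ.edgeVerts (C₁ ∪ C₂)} = C₁ ∪ C₂ := by
      ext e
      exact ⟨fun h => h.1, fun h => ⟨h, ⟨e, h, Or.inl rfl⟩, ⟨e, h, Or.inr rfl⟩⟩⟩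
    rw [← this]
    simp only [this]
    conv_rhs => rw [← this]
    rfl
  rw [cV, cE] at hcard
  have f₁ : C₁.Finite := by rw [e₁]; exact List.finite_toSet _
  have f₂ : C₂.Finite := by rw [e₂]; exact List.finite_toSet _
  have g₁ : (Γ.edgeVerts C₁).Finite := by
    rw [e₁, edgeVerts_closed w₁]; exact List.finite_toSet _
  have g₂ : (Γ.edgeVerts C₂).Finite := by
    rw [e₂, edgeVerts_closed w₂]; exact List.finite_toSet _
  have u1 := Set.ncard_union_add_ncard_inter C₁ C₂ f₁ f₂
  have u2 := Set.ncard_union_add_ncard_inter (Γ.edgeVerts C₁) (Γ.edgeVerts C₂) g₁ g₂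
  have n1 := ncard_closed w₁ s₁
  have n2 := ncard_closed w₂ s₂
  have x1 := countP_exit w₁ s₁ C₂
  have x2 := countP_exit w₂ s₂ C₁
  rw [← e₁] at n1 x1
  rw [← e₂] at n2 x2
  rw [Set.inter_comm (Γ.edgeVerts C₂), Set.inter_comm C₂] at x2
  have y1 : l₁.countP (fun s => decide (Γ.stepStart s ∈ Γ.edgeVerts C₂ ∧ s.1 ∉ C₂)) = 1 := by
    omega
  have y2 : l₂.countP (fun s => decide (Γ.stepStart s ∈ Γ.edgeVerts C₁ ∧ s.1 ∉ C₁)) = 1 := by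
    omega
  -- the intersection contains an edge
  have hint : (C₁ ∩ C₂).Nonempty := by
    have hv : (Γ.edgeVerts C₁ ∩ Γ.edgeVerts C₂).Nonempty := by
      apply Set.nonempty_of_ncard_ne_zero
      omega
    obtain ⟨x, hx1, hx2⟩ := hv
    rw [e₁, edgeVerts_closed w₁] at hx1
    rw [e₂, edgeVerts_closed w₂] at hx2
    obtain ⟨s, t, hst, k1, k2, k3, k4⟩ := two_darts w₁ s₁ hx1
    obtain ⟨s', t', hst', k1', k2', k3', k4'⟩ := two_darts w₂ s₂ hx2
    by_contra hno
    have hdis : ∀ p q : Γ.Step, p.1 ∈ Γ.walkEdges l₁ → q.1 ∈ Γ.walkEdges l₂ → p ≠ q := by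
      rintro p q hp hq rfl
      apply hno
      refine ⟨p.1, ?_, ?_⟩
      · rw [e₁]; exact hp
      · rw [e₂]; exact hq
    have d1 := hdis s s' k1 k1'
    have d2 := hdis s t' k1 k2'
    have d3 := hdis t s' k2 k1'
    have d4 := hdis t t' k2 k2'
    refine no_four_darts hdeg x ![s, t, s', t'] ?_ ?_ ?_
    · intro i j hij
      fin_cases i <;> fin_cases j <;> simp_all
    · intro i
      rw [e₁, e₂]
      fin_cases i
      · exact Or.inl k1
      · exact Or.inl k2
      · exact Or.inr k1'
      · exact Or.inr k2'
    · intro i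
      fin_cases i
      · exact k3
      · exact k4
      · exact k3'
      · exact k4'
  obtain ⟨a, b, Q, P, wQ, wP, sQP, eQP, hQ, hQ2, hP2, hQa⟩ := decompose w₁ s₁ y1
  obtain ⟨a', b', Q', P', wQ', wP', sQP', eQP', hQ', hQ2', hP2', hQa'⟩ := decompose w₂ s₂ y2
  have m1 : ∀ e, e ∈ C₁ ↔ e ∈ Γ.walkEdges Q ∨ e ∈ Γ.walkEdges P := by
    intro e
    rw [e₁, Set.mem_ofPred_eq, eQP]
    simp [walkEdges]
  have m2 : ∀ e, e ∈ C₂ ↔ e ∈ Γ.walkEdges Q' ∨ e ∈ Γ.walkEdges P' := by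
    intro e
    rw [e₂, Set.mem_ofPred_eq, eQP']
    simp [walkEdges]
  have q1 : ∀ e ∈ Γ.walkEdges Q, e ∉ C₂ := by
    intro e he
    obtain ⟨s, hs, rfl⟩ := List.mem_map.1 he
    exact hQ2 s hs
  have q2 : ∀ e ∈ Γ.walkEdges Q', e ∉ C₁ := by
    intro e he
    obtain ⟨s, hs, rfl⟩ := List.mem_map.1 he
    exact hQ2' s hs
  have p1 : ∀ e ∈ Γ.walkEdges P, e ∈ C₂ := by
    intro e he
    obtain ⟨s, hs, rfl⟩ := List.mem_map.1 he
    exact hP2 s hs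
  have p2 : ∀ e ∈ Γ.walkEdges P', e ∈ C₁ := by
    intro e he
    obtain ⟨s, hs, rfl⟩ := List.mem_map.1 he
    exact hP2' s hs
  have pp : ∀ e, e ∈ Γ.walkEdges P ↔ e ∈ Γ.walkEdges P' := by
    intro e
    exact logic_inter (m1 e) (m2 e) (q1 e) (q2 e) (p1 e) (p2 e)
  have hPne : P ≠ [] ∧ P' ≠ [] := by
    obtain ⟨e, h1, h2⟩ := hint
    have he : e ∈ Γ.walkEdges P := ((m1 e).1 h1).resolve_left (fun h => q1 e h h2)
    constructor
    · rintro rfl; simp [walkEdges] at he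
    · rw [pp] at he
      rintro rfl; simp [walkEdges] at he
  obtain ⟨hab, -, -⟩ := P_nodup wQ wP sQP hPne.1 hQ
  obtain ⟨hab', hnQ', haQ'⟩ := P_nodup wQ' wP' sQP' hPne.2 hQ'
  have nE := sQP.2.1
  have nE' := sQP'.2.1
  have nS := sQP.2.2
  have nS' := sQP'.2.2
  simp only [walkEdges, List.map_append] at nE nE' nS nS'
  rw [List.nodup_append] at nE nE' nS nS'
  have perm : (Γ.walkEdges P).Perm (Γ.walkEdges P') :=
    (List.perm_ext_iff_of_nodup nE.2.1 nE'.2.1).2 pp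
  have hbd := walk_boundary wP
  rw [(perm.map _).sum_eq, walk_boundary wP'] at hbd
  have hends := ends_eq_of_boundary hab'.symm hbd
  -- gains
  have hgQ' : φ b' = φ a' * Γ.walkGain g Q' := by
    have gg := b₂ a' (Q' ++ P') (walk_append wQ' wP') sQP' (by
      rw [e₂]; ext e; exact eQP' e)
    rw [gain_append] at gg
    have := pot_walk (g := g) (φ := φ) wP' (fun s hs => hφ _ (hP2' s hs))
    rw [this, mul_assoc, mul_eq_one_iff_eq_inv.1 gg]
    simp
  have hgQ : φ b = φ a * Γ.walkGain g Q :=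
    pot_walk wQ (fun s hs => hφ _ ((m1 _).2 (Or.inl (List.mem_map_of_mem hs))))
  have inV1 : ∀ x ∈ Q.map Γ.stepStart, x ∈ Γ.edgeVerts C₁ := by
    intro x hx
    obtain ⟨s, hs, rfl⟩ := List.mem_map.1 hx
    exact start_mem_edgeVerts ((m1 _).2 (Or.inl (List.mem_map_of_mem hs)))
  have hsd : ∀ e, e ∈ symmDiff C₁ C₂ ↔ e ∈ Γ.walkEdges Q ∨ e ∈ Γ.walkEdges Q' := by
    intro e
    rw [Set.mem_symmDiff]
    exact logic_symm (m1 e) (m2 e) (q1 e) (q2 e) (p1 e) (p2 e)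
  have hQdis : ∀ e ∈ Γ.walkEdges Q, ∀ e' ∈ Γ.walkEdges Q', e ≠ e' := by
    rintro e he e' he' rfl
    exact q1 e he ((m2 e).2 (Or.inl he'))
  -- it suffices to find one simple closed walk with trivial gain
  suffices H : ∃ l, Γ.IsWalkFrom a a l ∧ Γ.IsSimpleClosed l ∧
      (∀ e, e ∈ symmDiff C₁ C₂ ↔ e ∈ Γ.walkEdges l) ∧ Γ.walkGain g l = 1 by
    obtain ⟨l, hw, hs, he, hg⟩ := H
    obtain ⟨ψ, hψ⟩ := pot_closed hw hs hg
    exact balanced_of_pot ⟨a, l, hw, hs, Set.ext he⟩ ψ (fun e h => hψ e ((he e).1 h))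
  rcases hends with ⟨rfl, rfl⟩ | ⟨rfl, rfl⟩
  · -- same direction: reverse the second path
    have wr := walk_rev wQ'
    refine ⟨Q ++ revWalk Q', walk_append wQ wr, ⟨by simp [hQ], ?_, ?_⟩, ?_, ?_⟩
    · have : Γ.walkEdges (Q ++ revWalk Q') = Γ.walkEdges Q ++ (Γ.walkEdges Q').reverse := by
        rw [← rev_edges]; simp [walkEdges]
      rw [this, List.nodup_append]
      refine ⟨nE.1, List.nodup_reverse.2 nE'.1, ?_⟩
      intro e he e' he'
      exact hQdis e he e' (List.mem_reverse.1 he')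
    · rw [List.map_append, rev_starts, List.nodup_append]
      refine ⟨nS.1, List.nodup_reverse.2 hnQ', ?_⟩
      rintro x hx y hy rfl
      rw [List.mem_reverse] at hy
      obtain ⟨t, ht, hte⟩ := List.mem_map.1 hy
      have hx2 : x ∈ Γ.edgeVerts C₂ := by
        rw [← hte]
        exact end_mem_edgeVerts ((m2 _).2 (Or.inl (List.mem_map_of_mem ht)))
      obtain ⟨s, hs, rfl⟩ := List.mem_map.1 hx
      rw [hQa s hs hx2] at hy
      exact haQ' hy
    · intro e
      rw [hsd]
      have : Γ.walkEdges (Q ++ revWalk Q') = Γ.walkEdges Q ++ (Γ.walkEdges Q').reverse := by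
        rw [← rev_edges]; simp [walkEdges]
      rw [this]; simp
    · have hQQ : Γ.walkGain g Q = Γ.walkGain g Q' := mul_left_cancel (hgQ.symm.trans hgQ')
      have hr : Γ.walkGain g Q' * Γ.walkGain g (revWalk Q') = 1 := by
        generalize Q' = l
        induction l with
        | nil => simp [walkGain, revWalk]
        | cons s l ih =>
          have h1 : revWalk (s :: l) = revWalk l ++ [flipStep s] := by simp [revWalk]
          have h2 : Γ.stepGain g s * Γ.stepGain g (flipStep s) = 1 := by
            obtain ⟨e, b⟩ := s
            cases b <;> simp [stepGain, flipStep]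
          rw [h1, gain_append, gain_cons, gain_cons, mul_assoc, ← mul_assoc (Γ.walkGain g l), ih]
          simpa [walkGain] using h2
      rw [gain_append, hQQ, hr]
  · refine ⟨Q ++ Q', walk_append wQ wQ', ⟨by simp [hQ], ?_, ?_⟩, ?_, ?_⟩
    · simp only [walkEdges, List.map_append]
      rw [List.nodup_append]
      exact ⟨nE.1, nE'.1, hQdis⟩
    · rw [List.map_append, List.nodup_append]
      refine ⟨nS.1, nS'.1, ?_⟩
      rintro x hx y hy rfl
      have hx1 := inV1 x hx
      obtain ⟨t, ht, hte⟩ := List.mem_map.1 hy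
      have hx2 : x ∈ Γ.edgeVerts C₂ := by
        rw [← hte]
        exact start_mem_edgeVerts ((m2 _).2 (Or.inl (List.mem_map_of_mem ht)))
      obtain ⟨s, hs, rfl⟩ := List.mem_map.1 hx
      have r1 := hQa s hs hx2
      have r2 := hQa' t ht (hte ▸ hx1)
      exact hab (r1.symm.trans (hte.symm.trans r2))
    · intro e
      rw [hsd]; simp [walkEdges]
    · rw [gain_append]
      rw [hgQ, mul_assoc] at hgQ'
      exact mul_eq_left.1 hgQ'.symm
end

section
/- Let 𝒢 be a class of groups. The Circle Test is valid for a graph Γ with respect to 𝒢 if and only if it is valid for every block of Γ with respect to 𝒢. -/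
set_option maxHeartbeats 1000000
set_option synthInstance.maxHeartbeats 400000

attribute [local instance] Classical.propDecidable

namespace CT

section Abstract

variable {E : Type} (W : Submodule (ZMod 2) (E →₀ ZMod 2))

lemma z2_cases (x : ZMod 2) : x = 0 ∨ x = 1 := by
  revert x; decide

lemma z2_ne_zero {x : ZMod 2} (h : x ≠ 0) : x = 1 := (z2_cases x).resolve_left h

lemma mem_supp {c : E →₀ ZMod 2} {e : E} : e ∈ c.support ↔ c e = 1 := by
  rw [Finsupp.mem_support_iff]
  refine ⟨z2_ne_zero, fun h => by rw [h]; decide⟩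

lemma eq_of_supp {c d : E →₀ ZMod 2} (h : ∀ e, e ∈ c.support ↔ e ∈ d.support) : c = d := by
  ext e
  have := h e
  simp only [Finsupp.mem_support_iff] at this
  rcases z2_cases (c e) with h1 | h1 <;> rcases z2_cases (d e) with h2 | h2 <;>
    simp_all

lemma mem_supp_add {c d : E →₀ ZMod 2} {e : E} :
    e ∈ (c + d).support ↔ ¬ (e ∈ c.support ↔ e ∈ d.support) := by
  simp only [mem_supp, Finsupp.add_apply]
  generalize c e = x
  generalize d e = y
  revert x y; decide

/-- Minimal nonzero elements. -/
def Circ (c : E →₀ ZMod 2) : Prop :=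
  c ∈ W ∧ c ≠ 0 ∧ ∀ u ∈ W, u ≠ 0 → u.support ⊆ c.support → u = c

variable {W}

lemma split_of_not_circ {w : E →₀ ZMod 2} (hw : w ∈ W) (h0 : w ≠ 0) (hc : ¬ Circ W w) :
    ∃ u v, u ∈ W ∧ v ∈ W ∧ u + v = w ∧ u.support ⊂ w.support ∧ v.support ⊂ w.support := by
  unfold Circ at hc
  push Not at hc
  obtain ⟨u, hu, hu0, hs, hne⟩ := hc hw h0
  have hss : u.support ⊂ w.support := by
    refine hs.ssubset_of_ne fun h => hne (eq_of_supp fun e => by rw [h])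
  refine ⟨u, w + u, hu, W.add_mem hw hu, ?_, hss, ?_⟩
  · apply eq_of_supp
    intro e
    simp only [mem_supp_add]
    tauto
  · rw [Finset.ssubset_iff_subset_ne]
    constructor
    · intro e he
      rw [mem_supp_add] at he
      by_contra h
      have : e ∉ u.support := fun h' => h (hs h')
      tauto
    · intro h
      obtain ⟨e, he⟩ := Finsupp.support_nonempty_iff.2 hu0
      have h1 := hs he
      have h2 : e ∈ (w + u).support := h ▸ h1
      rw [mem_supp_add] at h2
      tauto

lemma exists_circ {w : E →₀ ZMod 2} (hw : w ∈ W) {e : E} (he : e ∈ w.support) :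
    ∃ c, Circ W c ∧ e ∈ c.support ∧ c.support ⊆ w.support := by
  induction hn : w.support.card using Nat.strong_induction_on generalizing w with
  | _ n ih =>
    by_cases hc : Circ W w
    · exact ⟨w, hc, he, subset_rfl⟩
    · have h0 : w ≠ 0 := by rintro rfl; simp at he
      obtain ⟨u, v, hu, hv, huv, hus, hvs⟩ := split_of_not_circ hw h0 hc
      have : e ∈ u.support ∨ e ∈ v.support := by
        rw [← huv, mem_supp_add] at he
        tauto
      rcases this with h | h
      · obtain ⟨c, h1, h2, h3⟩ := ih _ (hn ▸ Finset.card_lt_card hus) hu h rfl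
        exact ⟨c, h1, h2, h3.trans hus.1⟩
      · obtain ⟨c, h1, h2, h3⟩ := ih _ (hn ▸ Finset.card_lt_card hvs) hv h rfl
        exact ⟨c, h1, h2, h3.trans hvs.1⟩

lemma mem_span_circ {w : E →₀ ZMod 2} (hw : w ∈ W) :
    w ∈ Submodule.span (ZMod 2) {c | Circ W c} := by
  induction hn : w.support.card using Nat.strong_induction_on generalizing w with
  | _ n ih =>
    by_cases h0 : w = 0
    · rw [h0]; exact Submodule.zero_mem _
    by_cases hc : Circ W w
    · exact Submodule.subset_span hc
    · obtain ⟨u, v, hu, hv, huv, hus, hvs⟩ := split_of_not_circ hw h0 hc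
      rw [← huv]
      exact Submodule.add_mem _ (ih _ (hn ▸ Finset.card_lt_card hus) hu rfl)
        (ih _ (hn ▸ Finset.card_lt_card hvs) hv rfl)

lemma Circ.eq_of_subset {c d : E →₀ ZMod 2} (hc : Circ W c) (hd : Circ W d)
    (h : d.support ⊆ c.support) : d = c := hc.2.2 d hd.1 hd.2.1 h

/-- If `e` is in the circuit `c`, `f` in the circuit `d` and the circuits meet, then
`e` and `f` are in a common circuit. -/
lemma circ_trans {e f : E} : ∀ (n : ℕ) (c d : E →₀ ZMod 2), Circ W c → Circ W d →
    (c.support ∪ d.support).card = n → e ∈ c.support → f ∈ d.support →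
    (∃ x, x ∈ c.support ∧ x ∈ d.support) →
    ∃ k, Circ W k ∧ e ∈ k.support ∧ f ∈ k.support := by
  intro n
  induction n using Nat.strong_induction_on with
  | _ n ih =>
    intro c d hc hd hn hec hfd ⟨x, hxc, hxd⟩
    by_contra hcon
    have hfc : f ∉ c.support := fun h => hcon ⟨c, hc, hec, h⟩
    have hed : e ∉ d.support := fun h => hcon ⟨d, hd, h, hfd⟩
    have hsum : c + d ∈ W := W.add_mem hc.1 hd.1
    obtain ⟨p, hp, hep, hps⟩ := exists_circ hsum (e := e) (mem_supp_add.2 (by tauto))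
    obtain ⟨q, hq, hfq, hqs⟩ := exists_circ hsum (e := f) (mem_supp_add.2 (by tauto))
    have hxp : x ∉ p.support := fun h => by have := mem_supp_add.1 (hps h); tauto
    have hxq : x ∉ q.support := fun h => by have := mem_supp_add.1 (hqs h); tauto
    -- `p` meets `d \ c`, `q` meets `c \ d`
    have hpd : ∃ y ∈ p.support, y ∈ d.support ∧ y ∉ c.support := by
      by_contra h
      push Not at h
      have hsub : p.support ⊆ c.support := fun y hy => by
        have := mem_supp_add.1 (hps hy)
        have := h y hy
        tauto
      have := hc.eq_of_subset hp hsub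
      subst this
      exact hxp hxc
    have hqc : ∃ y ∈ q.support, y ∈ c.support ∧ y ∉ d.support := by
      by_contra h
      push Not at h
      have hsub : q.support ⊆ d.support := fun y hy => by
        have := mem_supp_add.1 (hqs hy)
        have := h y hy
        tauto
      have := hd.eq_of_subset hq hsub
      subst this
      exact hxq hxd
    have hpu : ∀ y ∈ p.support, y ∈ c.support ∨ y ∈ d.support := fun y hy => by
      have := mem_supp_add.1 (hps hy); tauto
    have hqu : ∀ y ∈ q.support, y ∈ c.support ∨ y ∈ d.support := fun y hy => by
      have := mem_supp_add.1 (hqs hy); tauto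
    have key : ∀ a b : E →₀ ZMod 2, Circ W a → Circ W b → e ∈ a.support → f ∈ b.support →
        (∃ y, y ∈ a.support ∧ y ∈ b.support) →
        (∀ y ∈ a.support, y ∈ c.support ∨ y ∈ d.support) →
        (∀ y ∈ b.support, y ∈ c.support ∨ y ∈ d.support) →
        ∀ z, z ∈ c.support ∨ z ∈ d.support → z ∈ a.support ∨ z ∈ b.support := by
      intro a b ha hb hea hfb hab hau hbu z hz
      by_contra hz'
      refine hcon (ih _ ?_ a b ha hb rfl hea hfb hab)
      rw [← hn]
      apply Finset.card_lt_card
      rw [Finset.ssubset_iff_of_subset]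
      · exact ⟨z, Finset.mem_union.2 hz, fun h => hz' (Finset.mem_union.1 h)⟩
      · intro y hy
        rcases Finset.mem_union.1 hy with h | h
        · exact Finset.mem_union.2 (hau y h)
        · exact Finset.mem_union.2 (hbu y h)
    obtain ⟨y, hyp, hyd, hyc⟩ := hpd
    obtain ⟨z, hzq, hzc, hzd⟩ := hqc
    have h1 := key c q hc hq hec hfq ⟨z, hzc, hzq⟩ (fun y hy => Or.inl hy) hqu
    have hyq : y ∈ q.support := (h1 y (Or.inr hyd)).resolve_left hyc
    have h2 := key p q hp hq hep hfq ⟨y, hyp, hyq⟩ hpu hqu x (Or.inl hxc)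
    tauto

end Abstract

open MGraph

section Graph

variable {Γ : MGraph}

/-- The mod-2 chain of a list of steps. -/
noncomputable def chain (Γ : MGraph) (l : List Γ.Step) : Γ.E →₀ ZMod 2 :=
  (l.map fun s => Finsupp.single s.1 (1 : ZMod 2)).sum

lemma chain_cons (s : Γ.Step) (l : List Γ.Step) :
    chain Γ (s :: l) = Finsupp.single s.1 1 + chain Γ l := by
  simp [chain]

lemma chain_apply (l : List Γ.Step) (e : Γ.E) :
    chain Γ l e = (countIn (Γ.walkEdges l) e : ZMod 2) := by
  induction l with
  | nil => simp [chain, countIn, walkEdges]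
  | cons s l ih =>
    rw [chain_cons, Finsupp.add_apply, ih, Finsupp.single_apply]
    simp only [countIn, walkEdges, List.map_cons, List.sum_cons]
    push_cast
    congr 1

lemma cyc_iff (c : Γ.E →₀ ZMod 2) (l : List Γ.Step) :
    Γ.IsCyclicOrientation c l ↔ (∃ v, Γ.IsWalkFrom v v l) ∧ c = chain Γ l := by
  unfold IsCyclicOrientation
  refine and_congr_right fun _ => ?_
  rw [Finsupp.ext_iff]
  simp only [chain_apply]

lemma mem_supp_chain {l : List Γ.Step} (h : (Γ.walkEdges l).Nodup) {e : Γ.E} :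
    e ∈ (chain Γ l).support ↔ e ∈ Γ.walkEdges l := by
  induction l with
  | nil => simp [chain, walkEdges]
  | cons s l ih =>
    simp only [walkEdges, List.map_cons, List.nodup_cons] at h
    rw [chain_cons, mem_supp_add, ih h.2]
    simp only [walkEdges, List.map_cons, List.mem_cons]
    have : e ∈ (Finsupp.single s.1 (1 : ZMod 2)).support ↔ e = s.1 := by
      rw [mem_supp, Finsupp.single_apply]
      by_cases h' : s.1 = e
      · simp [h']
      · simp [h', Ne.symm h']
    rw [this]
    by_cases h' : e = s.1
    · subst h'
      simp [h.1]
    · simp only [h', false_or, false_iff, not_not]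

lemma boundary_single (e : Γ.E) (x : ZMod 2) :
    Γ.boundary (Finsupp.single e x) =
      Finsupp.single (Γ.src e) x + Finsupp.single (Γ.tgt e) x := by
  simp [boundary]

lemma src_tgt_step (s : Γ.Step) (x : ZMod 2) :
    Finsupp.single (Γ.src s.1) x + Finsupp.single (Γ.tgt s.1) x =
    Finsupp.single (Γ.stepStart s) x + Finsupp.single (Γ.stepEnd s) x := by
  rcases s with ⟨e, b⟩
  cases b
  · simp [stepStart, stepEnd, add_comm]
  · simp [stepStart, stepEnd]

lemma z2_add_self {X : Type} (f : X →₀ ZMod 2) : f + f = 0 := by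
  ext e
  simp only [Finsupp.add_apply, Finsupp.zero_apply]
  generalize f e = x
  revert x; decide

lemma boundary_chain {a b : Γ.V} {l : List Γ.Step} (h : Γ.IsWalkFrom a b l) :
    Γ.boundary (chain Γ l) = Finsupp.single a 1 + Finsupp.single b 1 := by
  induction h with
  | nil v => simp [chain, z2_add_self]
  | cons hs _ ih =>
    rw [chain_cons, map_add, ih, boundary_single, src_tgt_step, hs]
    rw [add_assoc, ← add_assoc _ _ (Finsupp.single _ _), z2_add_self, zero_add]

lemma chain_mem {v : Γ.V} {l : List Γ.Step} (h : Γ.IsWalkFrom v v l) :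
    chain Γ l ∈ Γ.cycleSpace := by
  rw [cycleSpace, LinearMap.mem_ker, boundary_chain h, z2_add_self]

lemma start_end {a b : Γ.V} {l : List Γ.Step} (h : Γ.IsWalkFrom a b l) :
    l.map Γ.stepStart ++ [b] = a :: l.map Γ.stepEnd := by
  induction h with
  | nil v => simp
  | cons hs _ ih => simp [ih, hs]

lemma end_nodup {a : Γ.V} {l : List Γ.Step} (h : Γ.IsWalkFrom a a l)
    (hn : (l.map Γ.stepStart).Nodup) : (l.map Γ.stepEnd).Nodup := by
  have h1 := start_end h
  have h2 : (l.map Γ.stepStart ++ [a]).Perm (a :: l.map Γ.stepStart) :=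
    List.perm_append_singleton _ _
  rw [h1] at h2
  exact (List.Perm.cons_inv h2).nodup_iff.2 hn

lemma walk_append {a b : Γ.V} {p q : List Γ.Step} (h : Γ.IsWalkFrom a b (p ++ q)) :
    ∃ c, Γ.IsWalkFrom a c p ∧ Γ.IsWalkFrom c b q := by
  induction p generalizing a with
  | nil => exact ⟨a, .nil _, h⟩
  | cons s p ih =>
    cases h with
    | cons hs h =>
      obtain ⟨c, h1, h2⟩ := ih h
      exact ⟨c, .cons hs h1, h2⟩

lemma boundary_apply (u : Γ.E →₀ ZMod 2) (v : Γ.V) :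
    Γ.boundary u v = ∑ e ∈ u.support,
      ((if Γ.src e = v then u e else 0) + (if Γ.tgt e = v then u e else 0)) := by
  rw [boundary, Finsupp.lsum_apply, Finsupp.sum, Finsupp.finsetSum_apply]
  refine Finset.sum_congr rfl fun e _ => ?_
  simp [Finsupp.single_apply]

lemma restrict_eq {l : List Γ.Step} (hn : (Γ.walkEdges l).Nodup) (u : Γ.E →₀ ZMod 2)
    (hu : ∀ e ∈ u.support, e ∈ Γ.walkEdges l) :
    u = (l.map fun s => Finsupp.single s.1 (u s.1)).sum := by
  classical
  ext e
  have : ∀ l : List Γ.Step, (Γ.walkEdges l).Nodup →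
      (l.map fun s => Finsupp.single s.1 (u s.1)).sum e =
      if e ∈ Γ.walkEdges l then u e else 0 := by
    intro l
    induction l with
    | nil => simp [walkEdges]
    | cons s l ih =>
      intro h
      simp only [walkEdges, List.map_cons, List.nodup_cons] at h
      rw [List.map_cons, List.sum_cons, Finsupp.add_apply, ih h.2, Finsupp.single_apply]
      by_cases h' : s.1 = e
      · subst h'
        have h1 : s.1 ∉ Γ.walkEdges l := h.1
        have h2 : s.1 ∈ Γ.walkEdges (s :: l) := List.mem_cons_self
        rw [if_neg h1, if_pos h2, if_pos rfl, add_zero]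
      · simp [h', Ne.symm h', walkEdges]
  rw [this l hn]
  split_ifs with h
  · rfl
  · by_contra h'
    exact h (hu e (Finsupp.mem_support_iff.2 h'))

lemma consecutive {v : Γ.V} {l : List Γ.Step} (hw : Γ.IsWalkFrom v v l)
    (hs : Γ.IsSimpleClosed l) {u : Γ.E →₀ ZMod 2} (hu : u ∈ Γ.cycleSpace)
    (hsub : ∀ e ∈ u.support, e ∈ Γ.walkEdges l) {p q : List Γ.Step} {s t : Γ.Step}
    (hl : l = p ++ s :: t :: q) : u s.1 = u t.1 := by
  have hend := end_nodup hw hs.2.2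
  have hst := hs.2.2
  have h0 : Γ.boundary u = 0 := hu
  rw [restrict_eq hs.2.1 u hsub, map_list_sum, List.map_map] at h0
  have hf : (Γ.boundary ∘ fun s : Γ.Step => Finsupp.single s.1 (u s.1)) =
      fun s : Γ.Step => Finsupp.single (Γ.stepStart s) (u s.1) +
        Finsupp.single (Γ.stepEnd s) (u s.1) := by
    funext s
    simp [boundary_single, src_tgt_step]
  rw [hf] at h0
  subst hl
  obtain ⟨x, _, h2⟩ := walk_append hw
  have hx : Γ.stepStart t = Γ.stepEnd s := by
    cases h2 with
    | cons _ h2 => cases h2 with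
      | cons h _ => exact h
  have hzero : ∀ r : List Γ.Step, (∀ y ∈ r, Γ.stepStart y ≠ Γ.stepStart t) →
      (∀ y ∈ r, Γ.stepEnd y ≠ Γ.stepEnd s) →
      (r.map fun s : Γ.Step => Finsupp.single (Γ.stepStart s) (u s.1) +
        Finsupp.single (Γ.stepEnd s) (u s.1)).sum (Γ.stepStart t) = 0 := by
    intro r
    induction r with
    | nil => simp
    | cons y r ih =>
      intro h1 h2
      rw [List.map_cons, List.sum_cons, Finsupp.add_apply, Finsupp.add_apply,
        ih (fun y hy => h1 y (List.mem_cons_of_mem _ hy))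
          (fun y hy => h2 y (List.mem_cons_of_mem _ hy)), Finsupp.single_apply,
        Finsupp.single_apply, if_neg (h1 y List.mem_cons_self),
        if_neg (by rw [hx]; exact h2 y List.mem_cons_self)]
      simp
  simp only [List.map_append, List.map_cons, List.nodup_append, List.nodup_cons,
    List.mem_cons, List.mem_map] at hend hst
  have hp := hzero p
    (fun y hy => hst.2.2 _ ⟨y, hy, rfl⟩ _ (Or.inr (Or.inl rfl)))
    (fun y hy => hend.2.2 _ ⟨y, hy, rfl⟩ _ (Or.inl rfl))
  have hq := hzero q
    (fun y hy h => hst.2.1.2.1 ⟨y, hy, h⟩)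
    (fun y hy h => hend.2.1.1 (Or.inr ⟨y, hy, h⟩))
  have h1 := DFunLike.congr_fun h0 (Γ.stepStart t)
  have n1 : Γ.stepStart s ≠ Γ.stepStart t := fun h => hst.2.1.1 (Or.inl h)
  have n2 : Γ.stepEnd t ≠ Γ.stepStart t := fun h =>
    hend.2.1.1 (Or.inl (by rw [h, hx]))
  rw [List.map_append, List.sum_append, List.map_cons, List.map_cons, List.sum_cons,
    List.sum_cons] at h1
  simp only [Finsupp.add_apply, hp, hq, Finsupp.single_apply, if_neg n1, if_neg n2,
    if_pos hx.symm, if_true, Finsupp.zero_apply, zero_add, add_zero] at h1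
  generalize u s.1 = x at *
  generalize u t.1 = y at *
  revert h1
  clear * -
  revert x y
  decide

lemma simple_circ {v : Γ.V} {l : List Γ.Step} (hw : Γ.IsWalkFrom v v l)
    (hs : Γ.IsSimpleClosed l) : Circ Γ.cycleSpace (chain Γ l) := by
  refine ⟨chain_mem hw, ?_, ?_⟩
  · obtain ⟨s, hsl⟩ := List.exists_mem_of_ne_nil l hs.1
    intro h
    have := (mem_supp_chain hs.2.1).2 (List.mem_map_of_mem (f := Prod.fst) hsl)
    rw [h] at this
    simp at this
  · intro u hu hu0 hsub
    have hsub' : ∀ e ∈ u.support, e ∈ Γ.walkEdges l := fun e he =>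
      (mem_supp_chain hs.2.1).1 (hsub he)
    have hc : List.IsChain (fun s t : Γ.Step => u s.1 = u t.1) l := by
      rw [List.isChain_iff_forall_rel_of_append_cons_cons]
      intro s t p q hl
      exact consecutive hw hs hu hsub' hl
    have : IsTrans Γ.Step (fun s t : Γ.Step => u s.1 = u t.1) := ⟨fun _ _ _ => Eq.trans⟩
    have hp := List.isChain_iff_pairwise.1 hc
    have hall : ∀ s ∈ l, ∀ t ∈ l, u s.1 = u t.1 := by
      intro s hs t ht
      by_cases hst : s = t
      · rw [hst]
      have : Std.Symm (fun s t : Γ.Step => u s.1 = u t.1) := ⟨fun _ _ => Eq.symm⟩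
      exact hp.forall hs ht hst
    obtain ⟨e, he⟩ := Finsupp.support_nonempty_iff.2 hu0
    obtain ⟨s, hsl, rfl⟩ := List.mem_map.1 (hsub' e he)
    apply eq_of_supp
    intro f
    refine ⟨fun h => hsub h, fun h => ?_⟩
    obtain ⟨t, htl, rfl⟩ := List.mem_map.1 ((mem_supp_chain hs.2.1).1 h)
    rw [Finsupp.mem_support_iff, ← hall s hsl t htl]
    exact Finsupp.mem_support_iff.1 he

lemma walk_concat {a b c : Γ.V} {p q : List Γ.Step} (h : Γ.IsWalkFrom a b p)
    (h' : Γ.IsWalkFrom b c q) : Γ.IsWalkFrom a c (p ++ q) := by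
  induction h with
  | nil _ => exact h'
  | cons hs _ ih => exact .cons hs (ih h')

lemma step_ends {x y : Γ.Step} (h : x.1 = y.1) :
    Γ.stepStart x = Γ.stepEnd y ∨ Γ.stepEnd x = Γ.stepEnd y := by
  rcases x with ⟨e, b⟩
  rcases y with ⟨f, d⟩
  simp only at h
  subst h
  cases b <;> cases d <;> simp [stepStart, stepEnd]

lemma exists_step_end {e : Γ.E} {a : Γ.V} (h : Γ.src e = a ∨ Γ.tgt e = a) :
    ∃ s : Γ.Step, s.1 = e ∧ Γ.stepEnd s = a := by
  rcases h with h | h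
  · exact ⟨(e, false), rfl, by simpa [stepEnd] using h⟩
  · exact ⟨(e, true), rfl, by simpa [stepEnd] using h⟩

lemma start_ne_end {s : Γ.Step} (h : Γ.src s.1 ≠ Γ.tgt s.1) : Γ.stepStart s ≠ Γ.stepEnd s := by
  rcases s with ⟨e, b⟩
  cases b
  · simpa [stepStart, stepEnd] using h.symm
  · simpa [stepStart, stepEnd] using h

/-- Paths whose edges belong to `u`. -/
def PathIn (u : Γ.E →₀ ZMod 2) (a b : Γ.V) (l : List Γ.Step) : Prop :=
  Γ.IsWalkFrom a b l ∧ (a :: l.map Γ.stepEnd).Nodup ∧ (Γ.walkEdges l).Nodup ∧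
    ∀ e ∈ Γ.walkEdges l, e ∈ u.support

/-- There is a simple closed walk whose edges belong to `u`. -/
def HasSimple (u : Γ.E →₀ ZMod 2) : Prop :=
  ∃ v l, Γ.IsWalkFrom v v l ∧ Γ.IsSimpleClosed l ∧ ∀ e ∈ Γ.walkEdges l, e ∈ u.support

lemma extend_path {u : Γ.E →₀ ZMod 2} (hu : u ∈ Γ.cycleSpace)
    (hloop : ∀ e ∈ u.support, Γ.src e ≠ Γ.tgt e) (hno : ¬ HasSimple u)
    {a b : Γ.V} {s : Γ.Step} {l : List Γ.Step} (hp : PathIn u a b (s :: l)) :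
    ∃ a' s', PathIn u a' b (s' :: s :: l) := by
  obtain ⟨hw, hv, he, hsup⟩ := hp
  have hsa : Γ.stepStart s = a := by cases hw with | cons h _ => exact h
  have hs1 : s.1 ∈ u.support := hsup _ (by simp [walkEdges])
  have hex : ∃ e' ∈ u.support, e' ≠ s.1 ∧ (Γ.src e' = a ∨ Γ.tgt e' = a) := by
    by_contra hcon
    push Not at hcon
    have h0 : Γ.boundary u a = 0 := by
      have : Γ.boundary u = 0 := hu
      rw [this]; rfl
    rw [boundary_apply, Finset.sum_eq_single s.1] at h0
    · have hne := hloop _ hs1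
      rw [mem_supp.1 hs1] at h0
      rcases s with ⟨e, d⟩
      cases d
      · have h1 : Γ.tgt e = a := by simpa [stepStart] using hsa
        have h2 : Γ.src e ≠ a := by rw [← h1]; exact hne
        simp [h1, h2] at h0
      · have h1 : Γ.src e = a := by simpa [stepStart] using hsa
        have h2 : Γ.tgt e ≠ a := by rw [← h1]; exact hne.symm
        simp [h1, h2] at h0
    · intro e' he' hne
      have := hcon e' he' hne
      simp [this.1, this.2]
    · intro h; exact absurd hs1 h
  obtain ⟨e', he', hne, hinc⟩ := hex
  obtain ⟨s', rfl, hs'⟩ := exists_step_end hinc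
  have hwa : Γ.stepStart s' ≠ a := by
    rw [← hs']; exact start_ne_end (hloop _ he')
  have hse := start_end hw
  -- the new edge is not an old one
  have hnew : s'.1 ∉ Γ.walkEdges (s :: l) := by
    intro hmem
    obtain ⟨x, hx, hxe⟩ := List.mem_map.1 hmem
    have hxs : x ≠ s := by rintro rfl; exact hne hxe.symm
    have hxl : x ∈ l := (List.mem_cons.1 hx).resolve_left hxs
    rcases step_ends hxe with h | h
    · have hn : (List.map Γ.stepStart (s :: l) ++ [b]).Nodup := by rw [hse]; exact hv
      rw [List.map_cons, List.cons_append, List.nodup_cons] at hn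
      apply hn.1
      rw [hsa, ← hs', ← h]
      exact List.mem_append_left _ (List.mem_map_of_mem hxl)
    · rw [List.nodup_cons] at hv
      apply hv.1
      rw [← hs', ← h]
      exact List.mem_map_of_mem hx
  by_cases hmem : Γ.stepStart s' ∈ (s :: l).map Γ.stepEnd
  · exfalso
    obtain ⟨t, ht, hte⟩ := List.mem_map.1 hmem
    obtain ⟨p, q, hpq⟩ := List.append_of_mem ht
    have hpq' : s :: l = (p ++ [t]) ++ q := by simp [hpq]
    rw [hpq'] at hw hv he hsup hnew
    obtain ⟨c, hw1, hw2⟩ := walk_append hw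
    have hc : c = Γ.stepStart s' := by
      obtain ⟨d, _, hd⟩ := walk_append hw1
      cases hd with
      | cons _ hd => cases hd with
        | nil => exact hte
    subst hc
    refine hno ⟨Γ.stepStart s', s' :: (p ++ [t]), .cons rfl (hs' ▸ hw1), ⟨by simp, ?_, ?_⟩, ?_⟩
    · rw [walkEdges, List.map_append] at he hnew
      rw [walkEdges, List.map_cons, List.nodup_cons]
      exact ⟨fun h => hnew (List.mem_append_left _ h), he.of_append_left⟩
    · have h1 := start_end hw1
      rw [List.map_append, ← List.cons_append] at hv
      have h2 := hv.of_append_left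
      rw [← h1] at h2
      rw [List.map_cons]
      exact (List.perm_append_singleton _ _).nodup_iff.1 h2
    · intro e hee
      rw [walkEdges, List.map_cons, List.mem_cons] at hee
      rcases hee with rfl | hee
      · exact he'
      · apply hsup
        rw [walkEdges, List.map_append]
        exact List.mem_append_left _ hee
  · refine ⟨Γ.stepStart s', s', .cons rfl (hs' ▸ hw), ?_, ?_, ?_⟩
    · rw [List.map_cons, hs', List.nodup_cons]
      refine ⟨fun h => ?_, hv⟩
      rcases List.mem_cons.1 h with h | h
      · exact hwa h
      · exact hmem h
    · exact List.nodup_cons.2 ⟨hnew, he⟩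
    · intro e hee
      rcases List.mem_cons.1 hee with rfl | hee
      · exact he'
      · exact hsup e hee

lemma exists_simple {u : Γ.E →₀ ZMod 2} (hu : u ∈ Γ.cycleSpace) (h0 : u ≠ 0) :
    HasSimple u := by
  by_contra hno
  have hloop : ∀ e ∈ u.support, Γ.src e ≠ Γ.tgt e := by
    intro e he h
    refine hno ⟨Γ.src e, [(e, true)], .cons (by simp [stepStart]) ?_,
      ⟨by simp, by simp [walkEdges], by simp⟩, ?_⟩
    · have : Γ.stepEnd (e, true) = Γ.src e := by simp [stepEnd, h]
      rw [this]; exact .nil _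
    · intro f hf
      simp only [walkEdges, List.map_cons, List.map_nil, List.mem_singleton] at hf
      rw [hf]; exact he
  have hlong : ∀ n : ℕ, ∃ a b s l, PathIn u a b (s :: l) ∧ l.length = n := by
    intro n
    induction n with
    | zero =>
      obtain ⟨e, he⟩ := Finsupp.support_nonempty_iff.2 h0
      refine ⟨Γ.src e, Γ.tgt e, (e, true), [], ⟨.cons (by simp [stepStart]) ?_, ?_, ?_, ?_⟩, rfl⟩
      · have : Γ.stepEnd (e, true) = Γ.tgt e := by simp [stepEnd]
        rw [this]; exact .nil _
      · simpa [stepEnd] using hloop e he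
      · simp [walkEdges]
      · intro f hf
        simp only [walkEdges, List.map_cons, List.map_nil, List.mem_singleton] at hf
        rw [hf]; exact he
    | succ n ih =>
      obtain ⟨a, b, s, l, hp, hl⟩ := ih
      obtain ⟨a', s', hp'⟩ := extend_path hu hloop hno hp
      exact ⟨a', b, s', s :: l, hp', by simp [hl]⟩
  obtain ⟨a, b, s, l, hp, hl⟩ := hlong u.support.card
  have h1 : (Γ.walkEdges (s :: l)).toFinset ⊆ u.support := by
    intro e he
    exact hp.2.2.2 e (List.mem_toFinset.1 he)
  have h2 := Finset.card_le_card h1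
  rw [List.toFinset_card_of_nodup hp.2.2.1] at h2
  simp only [walkEdges, List.map_cons, List.length_cons, List.length_map] at h2
  omega

lemma circ_exists_walk {c : Γ.E →₀ ZMod 2} (hc : Circ Γ.cycleSpace c) :
    ∃ v l, Γ.IsWalkFrom v v l ∧ Γ.IsSimpleClosed l ∧ c = chain Γ l := by
  obtain ⟨v, l, hw, hs, hsub⟩ := exists_simple hc.1 hc.2.1
  refine ⟨v, l, hw, hs, ?_⟩
  have h := simple_circ hw hs
  exact (hc.eq_of_subset h fun e he => hsub e ((mem_supp_chain hs.2.1).1 he)).symm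

/-! ### Subgraphs -/

variable (D : Set Γ.E)

/-- Inclusion of the edges of a subgraph. -/
def inc (e : (Γ.edgeSubgraph D).E) : Γ.E := e.1

lemma inc_inj : Function.Injective (inc D) := Subtype.val_injective

lemma inc_mem (e : (Γ.edgeSubgraph D).E) : inc D e ∈ D := e.2.1

/-- The edge of the subgraph given by an edge in `D`. -/
def mkE {e : Γ.E} (h : e ∈ D) : (Γ.edgeSubgraph D).E :=
  ⟨e, h, ⟨e, h, Or.inl rfl⟩, ⟨e, h, Or.inr rfl⟩⟩

lemma inc_mkE {e : Γ.E} (h : e ∈ D) : inc D (mkE D h) = e := rfl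

/-- Inclusion of vertices. -/
def incV (v : (Γ.edgeSubgraph D).V) : Γ.V := v.1

lemma incV_inj : Function.Injective (incV D) := Subtype.val_injective

/-- Inclusion of steps. -/
def incS (s : (Γ.edgeSubgraph D).Step) : Γ.Step := (inc D s.1, s.2)

lemma start_incS (s : (Γ.edgeSubgraph D).Step) :
    Γ.stepStart (incS D s) = incV D ((Γ.edgeSubgraph D).stepStart s) := by
  rcases s with ⟨e, b⟩
  cases b <;> rfl

lemma end_incS (s : (Γ.edgeSubgraph D).Step) :
    Γ.stepEnd (incS D s) = incV D ((Γ.edgeSubgraph D).stepEnd s) := by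
  rcases s with ⟨e, b⟩
  cases b <;> rfl

lemma walk_cons_inv {Δ : MGraph} {a b : Δ.V} {s : Δ.Step} {l : List Δ.Step}
    (h : Δ.IsWalkFrom a b (s :: l)) : Δ.stepStart s = a ∧ Δ.IsWalkFrom (Δ.stepEnd s) b l := by
  cases h with
  | cons h1 h2 => exact ⟨h1, h2⟩

lemma walk_inc {a b : (Γ.edgeSubgraph D).V} {l : List (Γ.edgeSubgraph D).Step} :
    Γ.IsWalkFrom (incV D a) (incV D b) (l.map (incS D)) ↔ (Γ.edgeSubgraph D).IsWalkFrom a b l := by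
  induction l generalizing a with
  | nil =>
    constructor
    · intro h
      have h1 := start_end h
      simp only [List.map_nil, List.nil_append, List.cons.injEq, and_true] at h1
      have := incV_inj D h1
      subst this
      exact .nil _
    · intro h
      have h1 := start_end h
      simp only [List.map_nil, List.nil_append, List.cons.injEq, and_true] at h1
      rw [h1]
      exact .nil _
  | cons s l ih =>
    constructor
    · intro h
      rw [List.map_cons] at h
      obtain ⟨h1, h2⟩ := walk_cons_inv h
      · rw [start_incS] at h1
        rw [end_incS] at h2
        exact .cons (incV_inj D h1) (ih.1 h2)
    · intro h
      obtain ⟨h1, h2⟩ := walk_cons_inv h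
      · refine .cons (by rw [start_incS, h1]) ?_
        rw [end_incS]
        exact ih.2 h2

lemma walkEdges_inc (l : List (Γ.edgeSubgraph D).Step) :
    Γ.walkEdges (l.map (incS D)) = ((Γ.edgeSubgraph D).walkEdges l).map (inc D) := by
  simp [walkEdges, incS, Function.comp_def]

lemma simple_inc {l : List (Γ.edgeSubgraph D).Step} :
    Γ.IsSimpleClosed (l.map (incS D)) ↔ (Γ.edgeSubgraph D).IsSimpleClosed l := by
  unfold IsSimpleClosed
  rw [walkEdges_inc, List.nodup_map_iff (inc_inj D), List.map_map]
  have : Γ.stepStart ∘ incS D = incV D ∘ (Γ.edgeSubgraph D).stepStart := by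
    funext s; exact start_incS D s
  rw [this, ← List.map_map, List.nodup_map_iff (incV_inj D)]
  simp

lemma gain_inc {G : Type} [Group G] (g : Γ.E → G) (l : List (Γ.edgeSubgraph D).Step) :
    Γ.walkGain g (l.map (incS D)) = (Γ.edgeSubgraph D).walkGain (g ∘ inc D) l := by
  unfold walkGain
  rw [List.map_map]
  rfl

lemma exists_lift {v : Γ.V} {l : List Γ.Step} (hw : Γ.IsWalkFrom v v l)
    (hs : Γ.IsSimpleClosed l) (hD : ∀ e ∈ Γ.walkEdges l, e ∈ D) :
    ∃ v' l', l = l'.map (incS D) ∧ (Γ.edgeSubgraph D).IsWalkFrom v' v' l' ∧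
      (Γ.edgeSubgraph D).IsSimpleClosed l' := by
  have h1 : ∃ l' : List (Γ.edgeSubgraph D).Step, l = l'.map (incS D) := by
    clear hw hs
    induction l with
    | nil => exact ⟨[], rfl⟩
    | cons s l ih =>
      obtain ⟨l', hl'⟩ := ih fun e he => hD e (List.mem_cons_of_mem _ he)
      have hsD : s.1 ∈ D := hD _ List.mem_cons_self
      exact ⟨(mkE D hsD, s.2) :: l', by rw [List.map_cons, ← hl']; rfl⟩
  obtain ⟨l', rfl⟩ := h1
  have hsimple := (simple_inc D).1 hs
  have hv : ∃ v', incV D v' = v := by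
    cases l' with
    | nil => exact absurd rfl hsimple.1
    | cons s l' =>
      rw [List.map_cons] at hw
      cases hw with
      | cons h _ => exact ⟨_, (start_incS D s).symm.trans h⟩
  obtain ⟨v', rfl⟩ := hv
  exact ⟨v', l', rfl, (walk_inc D).1 hw, hsimple⟩

/-- Extension of chains by zero. -/
noncomputable def push : ((Γ.edgeSubgraph D).E →₀ ZMod 2) →ₗ[ZMod 2] (Γ.E →₀ ZMod 2) :=
  Finsupp.lmapDomain (ZMod 2) (ZMod 2) (inc D)

lemma push_inj : Function.Injective (push D) := Finsupp.mapDomain_injective (inc_inj D)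

lemma push_single (e : (Γ.edgeSubgraph D).E) (x : ZMod 2) :
    push D (Finsupp.single e x) = Finsupp.single (inc D e) x := by
  simp [push]

lemma push_chain (l : List (Γ.edgeSubgraph D).Step) :
    push D (chain _ l) = chain Γ (l.map (incS D)) := by
  induction l with
  | nil => simp [chain]
  | cons s l ih => rw [List.map_cons, chain_cons, chain_cons, map_add, ih, push_single]; rfl

lemma boundary_push (c : (Γ.edgeSubgraph D).E →₀ ZMod 2) :
    Γ.boundary (push D c) = Finsupp.mapDomain (incV D) ((Γ.edgeSubgraph D).boundary c) := by
  induction c using Finsupp.induction_linear with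
  | zero => simp
  | add f g hf hg => rw [map_add, map_add, map_add, hf, hg, Finsupp.mapDomain_add]
  | single e x =>
    rw [push_single, boundary_single, boundary_single, Finsupp.mapDomain_add,
      Finsupp.mapDomain_single, Finsupp.mapDomain_single]
    rfl

lemma push_mem {c : (Γ.edgeSubgraph D).E →₀ ZMod 2} :
    push D c ∈ Γ.cycleSpace ↔ c ∈ (Γ.edgeSubgraph D).cycleSpace := by
  unfold cycleSpace
  rw [LinearMap.mem_ker, LinearMap.mem_ker, boundary_push]
  constructor
  · intro h
    apply Finsupp.mapDomain_injective (incV_inj D)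
    rw [h, Finsupp.mapDomain_zero]
  · intro h
    rw [h, Finsupp.mapDomain_zero]

lemma push_apply (c : (Γ.edgeSubgraph D).E →₀ ZMod 2) (e) : push D c (inc D e) = c e :=
  Finsupp.mapDomain_apply (inc_inj D) _ _

lemma push_supp {c : (Γ.edgeSubgraph D).E →₀ ZMod 2} {e : Γ.E} (h : e ∈ (push D c).support) :
    e ∈ D := by
  have := Finsupp.mapDomain_support h
  obtain ⟨x, _, rfl⟩ := Finset.mem_image.1 this
  exact inc_mem D x

/-- Restriction of chains. -/
noncomputable def pull : (Γ.E →₀ ZMod 2) →ₗ[ZMod 2] ((Γ.edgeSubgraph D).E →₀ ZMod 2) :=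
  Finsupp.lcomapDomain (inc D) (inc_inj D)

lemma pull_apply (c : Γ.E →₀ ZMod 2) (e) : pull D c e = c (inc D e) := rfl

lemma pull_push (c : (Γ.edgeSubgraph D).E →₀ ZMod 2) : pull D (push D c) = c := by
  ext e
  rw [pull_apply, push_apply]

lemma push_pull {c : Γ.E →₀ ZMod 2} (h : ∀ e ∈ c.support, e ∈ D) : push D (pull D c) = c := by
  ext e
  by_cases he : e ∈ D
  · exact push_apply D (pull D c) (mkE D he)
  · have h1 : c e = 0 := by
      by_contra h'
      exact he (h e (Finsupp.mem_support_iff.2 h'))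
    rw [h1]
    by_contra h'
    exact he (push_supp D (Finsupp.mem_support_iff.2 h'))

lemma balanced_push {G : Type} [Group G] (g : Γ.E → G) (c : (Γ.edgeSubgraph D).E →₀ ZMod 2) :
    Γ.IsBalancedCircleCycle g (push D c) ↔
      (Γ.edgeSubgraph D).IsBalancedCircleCycle (g ∘ inc D) c := by
  unfold IsBalancedCircleCycle
  simp only [cyc_iff]
  constructor
  · rintro ⟨l, hs, ⟨⟨v, hw⟩, hc⟩, hg⟩
    obtain ⟨v', l', rfl, hw', hs'⟩ := exists_lift D hw hs fun e he =>
      push_supp D (by rw [hc]; exact (mem_supp_chain hs.2.1).2 he)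
    refine ⟨l', hs', ⟨⟨v', hw'⟩, push_inj D ?_⟩, ?_⟩
    · rw [hc, push_chain]
    · rw [← gain_inc, hg]
  · rintro ⟨l, hs, ⟨⟨v, hw⟩, hc⟩, hg⟩
    refine ⟨l.map (incS D), (simple_inc D).2 hs, ⟨⟨_, (walk_inc D).2 hw⟩, ?_⟩, ?_⟩
    · rw [hc, push_chain]
    · rw [gain_inc, hg]

lemma insep_iff : (Γ.edgeSubgraph D).Inseparable ↔
    ∀ e ∈ D, ∀ f ∈ D, e ≠ f → ∃ c, Circ Γ.cycleSpace c ∧ (∀ x ∈ c.support, x ∈ D) ∧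
      e ∈ c.support ∧ f ∈ c.support := by
  constructor
  · intro h e he f hf hne
    obtain ⟨v, l, hw, hs, h1, h2⟩ := h (mkE D he) (mkE D hf) fun h => hne (congrArg (inc D) h)
    have hs' := (simple_inc D).2 hs
    refine ⟨_, simple_circ ((walk_inc D).2 hw) hs', fun x hx => ?_, ?_, ?_⟩
    · rw [mem_supp_chain hs'.2.1, walkEdges_inc] at hx
      obtain ⟨y, _, rfl⟩ := List.mem_map.1 hx
      exact inc_mem D y
    · rw [mem_supp_chain hs'.2.1, walkEdges_inc]
      exact List.mem_map.2 ⟨_, h1, rfl⟩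
    · rw [mem_supp_chain hs'.2.1, walkEdges_inc]
      exact List.mem_map.2 ⟨_, h2, rfl⟩
  · intro h e f hne
    obtain ⟨c, hc, hD, h1, h2⟩ := h (inc D e) (inc_mem D e) (inc D f) (inc_mem D f)
      fun h => hne (inc_inj D h)
    obtain ⟨v, l, hw, hs, rfl⟩ := circ_exists_walk hc
    obtain ⟨v', l', rfl, hw', hs'⟩ := exists_lift D hw hs fun x hx =>
      hD x ((mem_supp_chain hs.2.1).2 hx)
    rw [mem_supp_chain hs.2.1, walkEdges_inc] at h1 h2
    refine ⟨v', l', hw', hs', ?_, ?_⟩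
    · exact (List.mem_map_of_injective (inc_inj D)).1 h1
    · exact (List.mem_map_of_injective (inc_inj D)).1 h2

/-- The edges that are equal to `e` or lie in a common circuit with `e`. -/
def cls (e : Γ.E) : Set Γ.E :=
  {f | e = f ∨ ∃ c, Circ Γ.cycleSpace c ∧ e ∈ c.support ∧ f ∈ c.support}

lemma circ_subset_cls {c : Γ.E →₀ ZMod 2} (hc : Circ Γ.cycleSpace c) {e x : Γ.E}
    (hx : x ∈ cls e) (hxc : x ∈ c.support) {f : Γ.E} (hf : f ∈ c.support) : f ∈ cls e := by
  rcases hx with rfl | ⟨d, hd, hed, hxd⟩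
  · exact Or.inr ⟨c, hc, hxc, hf⟩
  · exact Or.inr (circ_trans _ d c hd hc rfl hed hf ⟨x, hxd, hxc⟩)

lemma cls_insep (e : Γ.E) : (Γ.edgeSubgraph (cls e)).Inseparable := by
  rw [insep_iff]
  intro f hf f' hf' hne
  have : ∃ c, Circ Γ.cycleSpace c ∧ f ∈ c.support ∧ f' ∈ c.support := by
    rcases hf with rfl | ⟨d, hd, hed, hfd⟩
    · exact hf'.resolve_left hne
    · rcases hf' with rfl | ⟨d', hd', hed', hfd'⟩
      · exact ⟨d, hd, hfd, hed⟩
      · exact circ_trans _ d d' hd hd' rfl hfd hfd' ⟨e, hed, hed'⟩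
  obtain ⟨c, hc, h1, h2⟩ := this
  exact ⟨c, hc, fun x hx => circ_subset_cls hc hf h1 hx, h1, h2⟩

lemma insep_subset_cls {D : Set Γ.E} (h : (Γ.edgeSubgraph D).Inseparable) {e : Γ.E} (he : e ∈ D) :
    D ⊆ cls e := by
  rw [insep_iff] at h
  intro f hf
  by_cases hne : e = f
  · exact Or.inl hne
  · obtain ⟨c, hc, _, h1, h2⟩ := h e he f hf hne
    exact Or.inr ⟨c, hc, h1, h2⟩

lemma cls_block (e : Γ.E) : Γ.IsBlock (cls e) := by
  refine ⟨cls_insep e, fun D' hD' hi => ?_⟩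
  exact Set.Subset.antisymm (insep_subset_cls hi (hD' (Or.inl rfl))) hD'

lemma block_circ {D : Set Γ.E} (hD : Γ.IsBlock D) {c : Γ.E →₀ ZMod 2}
    (hc : Circ Γ.cycleSpace c) : (∀ e ∈ c.support, e ∈ D) ∨ (∀ e ∈ c.support, e ∉ D) := by
  by_cases h : ∃ e ∈ c.support, e ∈ D
  · left
    obtain ⟨e, hec, heD⟩ := h
    have : cls e = D := hD.2 _ (insep_subset_cls hD.1 heD) (cls_insep e)
    rw [← this]
    exact fun f hf => circ_subset_cls hc (Or.inl rfl) hec hf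
  · right
    push Not at h
    exact h

lemma balanced_circ {G : Type} [Group G] {g : Γ.E → G} {c : Γ.E →₀ ZMod 2}
    (h : Γ.IsBalancedCircleCycle g c) : Circ Γ.cycleSpace c := by
  obtain ⟨l, hs, hc, _⟩ := h
  rw [cyc_iff] at hc
  obtain ⟨⟨v, hw⟩, rfl⟩ := hc
  exact simple_circ hw hs

lemma valid_of_blocks (𝒢 : GroupClass)
    (h : ∀ D : Set Γ.E, Γ.IsBlock D → (Γ.edgeSubgraph D).CircleTestValidFor 𝒢) :
    Γ.CircleTestValidFor 𝒢 := by
  intro G _ hG g ⟨B, ⟨hBZ, hBi, hBs⟩, hBb⟩ v l hw hs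
  obtain ⟨s, hsl⟩ := List.exists_mem_of_ne_nil l hs.1
  have hblock := cls_block s.1
  have hlD : ∀ e ∈ Γ.walkEdges l, e ∈ cls s.1 := fun e he =>
    circ_subset_cls (simple_circ hw hs) (Or.inl rfl)
      ((mem_supp_chain hs.2.1).2 (List.mem_map_of_mem (f := Prod.fst) hsl))
      ((mem_supp_chain hs.2.1).2 he)
  generalize cls s.1 = D at hblock hlD
  obtain ⟨v', l', rfl, hw', hs'⟩ := exists_lift D hw hs hlD
  rw [gain_inc]
  refine h D hblock G hG (g ∘ inc D) ⟨push D ⁻¹' B, ⟨?_, ?_, ?_⟩, ?_⟩ v' l' hw' hs'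
  · intro c hc
    exact (push_mem D).1 (hBZ _ hc)
  · have h1 : LinearIndependent (ZMod 2) (fun c : (push D ⁻¹' B) => (⟨push D c.1, c.2⟩ : B).1) :=
      hBi.comp (fun c : (push D ⁻¹' B) => (⟨push D c.1, c.2⟩ : B)) (by
        intro x y hxy
        exact Subtype.ext (push_inj D (congrArg Subtype.val hxy)))
    exact LinearIndependent.of_comp (push D) h1
  · intro c hc
    have h1 := hBs _ ((push_mem D).2 hc)
    have h2 := Submodule.mem_map_of_mem (f := pull D) h1
    rw [pull_push, Submodule.map_span] at h2
    refine Submodule.span_le.2 ?_ h2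
    rintro _ ⟨b, hb, rfl⟩
    rcases block_circ hblock (balanced_circ (hBb b hb)) with hin | hout
    · apply Submodule.subset_span
      rw [Set.mem_preimage, push_pull D hin]
      exact hb
    · have : pull D b = 0 := by
        ext e
        rw [pull_apply]
        by_contra h'
        exact hout _ (Finsupp.mem_support_iff.2 h') (inc_mem D e)
      rw [this]
      exact Submodule.zero_mem _
  · intro c hc
    exact (balanced_push D g c).1 (hBb _ hc)

lemma blocks_of_valid (𝒢 : GroupClass) (h : Γ.CircleTestValidFor 𝒢) (hblock : Γ.IsBlock D) :
    (Γ.edgeSubgraph D).CircleTestValidFor 𝒢 := by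
  intro G _ hG g₀ ⟨B, ⟨hBZ, hBi, hBs⟩, hBb⟩ v l hw hs
  obtain ⟨g, hg, hg1⟩ : ∃ g : Γ.E → G, g ∘ inc D = g₀ ∧ ∀ e ∉ D, g e = 1 := by
    refine ⟨fun e => if he : e ∈ D then g₀ (mkE D he) else 1, ?_, ?_⟩
    · funext e
      exact dif_pos (inc_mem D e)
    · intro e he
      exact dif_neg he
  subst hg
  rw [← gain_inc]
  let S : Set (Γ.E →₀ ZMod 2) := {c | Circ Γ.cycleSpace c ∧ ∀ e ∈ c.support, e ∉ D}
  obtain ⟨B', hB'S, hB'span, hB'i⟩ := exists_linearIndependent (ZMod 2) S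
  refine h G hG g ⟨push D '' B ∪ B', ⟨?_, ?_, ?_⟩, ?_⟩ _ _ ((walk_inc D).2 hw)
    ((simple_inc D).2 hs)
  · rintro c (⟨c, hc, rfl⟩ | hc)
    · exact (push_mem D).2 (hBZ c hc)
    · exact (hB'S hc).1.1
  · have h1 : LinearIndepOn (ZMod 2) id (push D '' B) := by
      have hB : LinearIndepOn (ZMod 2) (push D) B :=
        hBi.map' (push D) (LinearMap.ker_eq_bot.2 (push_inj D))
      exact hB.id_image
    have h2 : LinearIndepOn (ZMod 2) id B' := hB'i
    refine LinearIndepOn.id_union h1 h2 ?_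
    refine Disjoint.mono (b := Finsupp.supported (ZMod 2) (ZMod 2) D)
      (d := Finsupp.supported (ZMod 2) (ZMod 2) Dᶜ) ?_ ?_ ?_
    · rw [Submodule.span_le]
      rintro _ ⟨c, _, rfl⟩
      exact fun e he => push_supp D he
    · rw [Submodule.span_le]
      intro c hc
      exact fun e he => (hB'S hc).2 e he
    · exact Finsupp.disjoint_supported_supported disjoint_compl_right
  · intro c hc
    refine Submodule.span_le.2 ?_ (mem_span_circ hc)
    intro d hd
    rcases block_circ hblock hd with hin | hout
    · apply Submodule.span_mono (Set.subset_union_left)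
      rw [← push_pull D hin, ← Submodule.map_span]
      apply Submodule.mem_map_of_mem
      apply hBs
      rw [← push_mem, push_pull D hin]
      exact hd.1
    · apply Submodule.span_mono (Set.subset_union_right)
      rw [hB'span]
      exact Submodule.subset_span ⟨hd, hout⟩
  · rintro c (⟨c, hc, rfl⟩ | hc)
    · exact (balanced_push D g c).2 (hBb c hc)
    · obtain ⟨hd, hout⟩ := hB'S hc
      obtain ⟨v, l, hw, hs, rfl⟩ := circ_exists_walk hd
      refine ⟨l, hs, (cyc_iff _ _).2 ⟨⟨v, hw⟩, rfl⟩, ?_⟩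
      apply List.prod_eq_one
      intro x hx
      obtain ⟨s, hsl, rfl⟩ := List.mem_map.1 hx
      have : g s.1 = 1 := hg1 _ (hout _ ((mem_supp_chain hs.2.1).2
        (List.mem_map_of_mem (f := Prod.fst) hsl)))
      simp [stepGain, this]

end Graph

end CT

/-- The Circle Test is valid for a graph with respect to a class
of groups if and only if it is valid for every block of the graph. -/
theorem circle_test_valid_iff_blocks (𝒢 : GroupClass) (Γ : MGraph) :
    Γ.CircleTestValidFor 𝒢 ↔
      ∀ D : Set Γ.E, Γ.IsBlock D → (Γ.edgeSubgraph D).CircleTestValidFor 𝒢 := by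
  exact ⟨fun h D hD => CT.blocks_of_valid D 𝒢 h hD, CT.valid_of_blocks 𝒢⟩
end

section
/- For every m ≥ 1 and every class 𝒢 of groups, the graph mK₂, consisting of two vertices joined by m parallel edges, is good with respect to 𝒢. -/
set_option maxHeartbeats 1000000
set_option synthInstance.maxHeartbeats 400000

attribute [local instance] Classical.propDecidable

theorem walk_singleton (Γ : MGraph) (a b : Γ.V) (s : Γ.Step) (h : Γ.IsWalkFrom a b [s]) :
    Γ.stepStart s = a ∧ Γ.stepEnd s = b := by
  cases h with
  | cons ha hw =>
    generalize Γ.stepEnd s = c at hw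
    cases hw
    exact ⟨ha, rfl⟩

/-- A simple closed walk in `mK₂` goes along one edge and comes back along another. -/
theorem banana_simple_closed (m : ℕ) (v : Bool) (l : List ((MGraph.banana m).Step))
    (hw : (MGraph.banana m).IsWalkFrom v v l) (hs : (MGraph.banana m).IsSimpleClosed l) :
    ∃ (x y : Fin m) (b : Bool), x ≠ y ∧ l = [(x, b), (y, !b)] := by
  obtain ⟨h0, h1, h2⟩ := hs
  have hlen : l.length ≤ 2 := by
    have h3 : (l.map (MGraph.banana m).stepStart).length ≤ Fintype.card Bool :=
      List.Nodup.length_le_card (α := Bool) h2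
    simpa using h3
  match l, h0, h1, h2, hlen, hw with
  | [(x, b)], _, _, _, _, hw =>
    obtain ⟨ha, hb⟩ := walk_singleton (MGraph.banana m) v v (x, b) hw
    have hab := ha.trans hb.symm
    cases b <;> simp [MGraph.stepStart, MGraph.stepEnd] at hab
  | [(x, b), (y, c)], _, h1, h2, _, _ =>
    refine ⟨x, y, b, ?_, ?_⟩
    · simpa [MGraph.walkEdges] using h1
    · cases b <;> cases c <;> simp [MGraph.stepStart] at h2 ⊢

theorem banana_gain (m : ℕ) {G : Type} [Group G] (g : Fin m → G) (x y : Fin m) (b : Bool) :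
    (MGraph.banana m).walkGain g [(x, b), (y, !b)] = 1 ↔ g x = g y := by
  cases b
  · simp [MGraph.walkGain, MGraph.stepGain, inv_mul_eq_one]
  · simp [MGraph.walkGain, MGraph.stepGain, mul_inv_eq_one]

/-- For every `m ≥ 1` and every class `𝒢` of groups, the graph
`mK₂` is good with respect to `𝒢`. -/
theorem mK2_good (𝒢 : GroupClass) (m : ℕ) (hm : 1 ≤ m) :
    (MGraph.banana m).CircleTestValidFor 𝒢 := by
  intro G _ _ g ⟨B, ⟨_, _, hspan⟩, hbal⟩ v l hw hs
  obtain ⟨e, f, b, hef, rfl⟩ := banana_simple_closed m v l hw hs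
  refine (banana_gain m g e f b).2 ?_
  by_contra hne
  -- the parity of the number of edges with the same gain as `e`
  let φ : (Fin m →₀ ZMod 2) →ₗ[ZMod 2] ZMod 2 :=
    Finsupp.lsum (ZMod 2) fun x => if g x = g e then LinearMap.id else 0
  have hφs : ∀ x (a : ZMod 2), φ (Finsupp.single x a) = if g x = g e then a else 0 := by
    intro x a
    simp only [φ, Finsupp.lsum_single]
    split_ifs <;> simp
  have hB : ∀ c ∈ B, φ c = 0 := by
    intro c hc
    obtain ⟨l, hl, ⟨⟨u, hu⟩, hcount⟩, hg⟩ := hbal c hc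
    obtain ⟨x, y, b', hxy, rfl⟩ := banana_simple_closed m u l hu hl
    have hgxy := (banana_gain m g x y b').1 hg
    have hceq : c = Finsupp.single x 1 + Finsupp.single y 1 := by
      ext z
      rw [hcount z]
      simp [countIn, MGraph.walkEdges, Finsupp.single_apply]
    rw [hceq, map_add, hφs, hφs, hgxy]
    exact CharTwo.add_self_eq_zero _
  have hle : Submodule.span (ZMod 2) B ≤ LinearMap.ker φ :=
    Submodule.span_le.2 fun c hc => hB c hc
  have hmem : (Finsupp.single e 1 + Finsupp.single f 1 : Fin m →₀ ZMod 2) ∈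
      (MGraph.banana m).cycleSpace := by
    change (MGraph.banana m).boundary _ = 0
    rw [map_add]
    simp only [MGraph.boundary, Finsupp.lsum_single]
    ext z
    simp only [Finsupp.add_apply, Finsupp.zero_apply]
    exact CharTwo.add_self_eq_zero _
  have h0 : φ (Finsupp.single e 1 + Finsupp.single f 1) = 0 := hle (hspan _ hmem)
  rw [map_add, hφs, hφs, if_pos rfl, if_neg (fun h => hne h.symm)] at h0
  simp at h0
end
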